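/- There exists a function f : ℕ → ℕ such that the following holds. Suppose V acts on the finite group G as in the context with C_G(V) = 1, and suppose the centralizers G₁ = C_G(v₁) and G₂ = C_G(v₂) of the two involutions v₁, v₂ ∈ V both have exponent dividing e. Then the exponent of the derived subgroup G′ of G is at most f(e). -/

import Mathlib

theorem odd_card_fixed {X : Type*} [Finite X] (f : X → X) (hf : ∀ x, f (f x) = x) :
    (Odd (Nat.card X) ↔ Odd (Nat.card {x // f x = x})) := by
  classical
  have := Fintype.ofFinite X
  have h := Equiv.Perm.card_fixedPoints_modEq (f := (f : Function.End X)) (p := 2) (n := 1)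
    (by funext x; simp; exact hf x)
  rw [Nat.odd_iff, Nat.odd_iff, Nat.card_eq_fintype_card, Nat.card_eq_fintype_card]
  have h2 : Fintype.card (Function.fixedPoints f) = Fintype.card {x // f x = x} :=
    Fintype.card_congr (Equiv.refl _)
  have h3 : Fintype.card X % 2 = Fintype.card (Function.fixedPoints f) % 2 := h
  rw [h3, h2]

theorem exists_common_fixed {X : Type*} [Finite X] (f g : X → X) (hf : ∀ x, f (f x) = x)
    (hg : ∀ x, g (g x) = x) (hfg : ∀ x, f (g x) = g (f x)) (hodd : Odd (Nat.card X)) :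
    ∃ x, f x = x ∧ g x = x := by
  have h1 := (odd_card_fixed f hf).1 hodd
  let g' : {x // f x = x} → {x // f x = x} := fun x => ⟨g x, by rw [hfg, x.2]⟩
  have h2 := (odd_card_fixed g' (fun x => Subtype.ext (hg x.1))).1 h1
  have : 0 < Nat.card {x // g' x = x} := h2.pos
  obtain ⟨⟨⟨x, hx⟩, hx2⟩⟩ := (Nat.card_pos_iff.1 this).1
  exact ⟨x, hx, congrArg Subtype.val hx2⟩

structure IsFour {G : Type*} [Group G] (v : Fin 3 → G →* G) : Prop where
  sq : ∀ i x, v i (v i x) = x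
  mul : ∀ i j k : Fin 3, i ≠ j → j ≠ k → i ≠ k → ∀ x, v i (v j x) = v k x
  fp : ∀ x, (∀ i, v i x = x) → x = 1

theorem third (i j : Fin 3) (h : i ≠ j) : ∃ k, i ≠ k ∧ j ≠ k := by
  revert i j; decide

theorem fin3_cases (i j k : Fin 3) (hij : i ≠ j) (hjk : j ≠ k) (hik : i ≠ k) (l : Fin 3) :
    l = i ∨ l = j ∨ l = k := by
  revert i j k l; decide

namespace IsFour
variable {G : Type*} [Group G] {v : Fin 3 → G →* G}

def Inv (v : Fin 3 → G →* G) (H : Subgroup G) : Prop := ∀ i, ∀ x ∈ H, v i x ∈ H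

def fix (v : Fin 3 → G →* G) (i : Fin 3) : Subgroup G where
  carrier := {x | v i x = x}
  mul_mem' := by intro a b ha hb; simp only [Set.mem_ofPred_eq] at *; rw [map_mul, ha, hb]
  one_mem' := map_one _
  inv_mem' := by intro a ha; simp only [Set.mem_ofPred_eq] at *; rw [map_inv, ha]

theorem mem_fix {i : Fin 3} {x : G} : x ∈ fix v i ↔ v i x = x := Iff.rfl

variable (hv : IsFour v)
include hv

theorem comm (i j : Fin 3) (x : G) : v i (v j x) = v j (v i x) := by
  by_cases h : i = j
  · rw [h]
  · obtain ⟨k, hik, hjk⟩ := third i j h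
    rw [hv.mul i j k h hjk hik, hv.mul j i k (Ne.symm h) hik hjk]

theorem fp2 {i j : Fin 3} (h : i ≠ j) {x : G} (hi : v i x = x) (hj : v j x = x) : x = 1 := by
  obtain ⟨k, hik, hjk⟩ := third i j h
  apply hv.fp
  intro l
  rcases fin3_cases i j k h hjk hik l with rfl | rfl | rfl
  · exact hi
  · exact hj
  · rw [← hv.mul _ _ _ h hjk hik, hj, hi]

theorem fix_inv {i j : Fin 3} {x : G} (hi : v i x = x) : v i (v j x) = v j x := by
  rw [hv.comm, hi]

variable [Finite G]

theorem odd_card : Odd (Nat.card G) := by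
  rw [odd_card_fixed (v 0) (hv.sq 0)]
  let g' : {x // v 0 x = x} → {x // v 0 x = x} := fun x => ⟨v 1 x, by rw [hv.comm, x.2]⟩
  rw [odd_card_fixed g' (fun x => Subtype.ext (hv.sq 1 x.1))]
  have : Nat.card {x // g' x = x} = 1 := by
    rw [Nat.card_eq_one_iff_unique]
    refine ⟨⟨?_⟩, ⟨⟨⟨1, map_one _⟩, Subtype.ext (map_one _)⟩⟩⟩
    rintro ⟨⟨x, hx⟩, hx2⟩ ⟨⟨y, hy⟩, hy2⟩
    have e1 : x = 1 := hv.fp2 (i := 0) (j := 1) (by decide) hx (congrArg Subtype.val hx2)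
    have e2 : y = 1 := hv.fp2 (i := 0) (j := 1) (by decide) hy (congrArg Subtype.val hy2)
    subst e1; subst e2; rfl
  rw [this]; decide

omit hv [Finite G] in
theorem _root_.sq_inj_odd (ho : Odd (Nat.card G)) {x y : G} (h : x * x = y * y) : x = y := by
  obtain ⟨k, hk⟩ := ho
  have e : ∀ z : G, z = (z * z) ^ (k + 1) := by
    intro z
    have : (z * z) ^ (k + 1) = z ^ (Nat.card G) * z := by
      rw [← pow_two, ← pow_mul, ← pow_succ, hk]; congr 1
    rw [this, pow_card_eq_one', one_mul]
  rw [e x, e y, h]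

omit hv [Finite G] in
/-- square root in a group of odd order -/
theorem _root_.exists_rt (ho : Odd (Nat.card G)) : ∃ m : ℕ, ∀ x : G, x ^ m * x ^ m = x := by
  obtain ⟨k, hk⟩ := ho
  refine ⟨k + 1, fun x => ?_⟩
  rw [← pow_add]
  have : x ^ (k + 1 + (k + 1)) = x ^ (Nat.card G) * x := by rw [← pow_succ, hk]; congr 1; ring
  rw [this, pow_card_eq_one', one_mul]

theorem sq_inj {x y : G} (h : x * x = y * y) : x = y := sq_inj_odd hv.odd_card h

/-- x * r fixed by i, with r in the cyclic group generated by `(v i x)⁻¹ * x`. -/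
theorem exists_root (i : Fin 3) (x : G) : ∃ r : G, r * r = (v i x)⁻¹ * x ∧ v i r = r⁻¹ ∧
    v i (x * r⁻¹) = x * r⁻¹ ∧ ∃ m : ℕ, r = ((v i x)⁻¹ * x) ^ m := by
  obtain ⟨m, hm⟩ := exists_rt hv.odd_card
  have h1 := hm ((v i x)⁻¹ * x)
  refine ⟨((v i x)⁻¹ * x) ^ m, h1, ?_, ?_, m, rfl⟩
  · rw [map_pow, ← inv_pow]; congr 1; simp [hv.sq]
  · have h2 : v i (((v i x)⁻¹ * x) ^ m) = (((v i x)⁻¹ * x) ^ m)⁻¹ := by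
      rw [map_pow, ← inv_pow]; congr 1; simp [hv.sq]
    rw [map_mul, map_inv, h2, inv_inv]
    generalize ((v i x)⁻¹ * x) ^ m = r at h1
    rw [eq_mul_inv_iff_mul_eq, mul_assoc, h1]; group

theorem inverts {i j : Fin 3} (h : i ≠ j) {x : G} (hi : v i x = x) : v j x = x⁻¹ := by
  obtain ⟨r, h1, h2, h3, m, h4⟩ := hv.exists_root j x
  have hri : v i r = r := by rw [h4, map_pow, map_mul, map_inv, hv.fix_inv hi, hi]
  have : x * r⁻¹ = 1 := hv.fp2 h (by rw [map_mul, map_inv, hi, hri]) h3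
  have hx : x = r := by rwa [mul_inv_eq_one] at this
  rw [hx, h2]

theorem fix_comm {i : Fin 3} {x y : G} (hx : v i x = x) (hy : v i y = y) : x * y = y * x := by
  obtain ⟨j, hj⟩ : ∃ j, i ≠ j := (by decide : ∀ i : Fin 3, ∃ j, i ≠ j) i
  have h := hv.inverts hj (x := x * y) (by rw [map_mul, hx, hy])
  rw [map_mul, hv.inverts hj hx, hv.inverts hj hy, mul_inv_rev] at h
  have := congrArg (·⁻¹) h
  simpa using this.symm

/-- decomposition -/
theorem decomp {H : Subgroup G} (hH : Inv v H) (k : Fin 3) {x : G} (hx : x ∈ H) :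
    ∃ y z, y ∈ H ∧ z ∈ H ∧ x = y * z ∧ v k y = y ∧ v k z = z⁻¹ := by
  obtain ⟨r, h1, h2, h3, m, h4⟩ := hv.exists_root k x
  have hr : r ∈ H := by rw [h4]; exact H.pow_mem (H.mul_mem (H.inv_mem (hH k x hx)) hx) m
  exact ⟨x * r⁻¹, r, H.mul_mem hx (H.inv_mem hr), hr, by group, h3, h2⟩

theorem decomp_inv {H : Subgroup G} (hH : Inv v H) {i j k : Fin 3} (hij : i ≠ j) (hjk : j ≠ k)
    (hik : i ≠ k) {w : G} (hw : w ∈ H) (hk : v k w = w⁻¹) :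
    ∃ s t, s ∈ H ∧ t ∈ H ∧ v i s = s ∧ v j t = t ∧ w = s * t * s := by
  obtain ⟨r, h1, h2, h3, m, h4⟩ := hv.exists_root i w
  have hr : r ∈ H := by rw [h4]; exact H.pow_mem (H.mul_mem (H.inv_mem (hH i w hw)) hw) m
  obtain ⟨n, hn⟩ := exists_rt hv.odd_card
  set a := w * r⁻¹ with ha
  have haH : a ∈ H := H.mul_mem hw (H.inv_mem hr)
  set s := a ^ n with hs
  have hss : s * s = a := hn a
  have his : v i s = s := by rw [hs, map_pow, h3]
  have hks : v k s = s⁻¹ := hv.inverts hik his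
  have hjs : v j s = s⁻¹ := hv.inverts hij his
  have hwsr : w = s * s * r := by rw [hss, ha]; group
  refine ⟨s, s * r * s⁻¹, H.pow_mem haH n, H.mul_mem (H.mul_mem (H.pow_mem haH n) hr)
    (H.inv_mem (H.pow_mem haH n)), his, ?_, by rw [hwsr]; group⟩
  -- v k r
  have hkr : s⁻¹ * s⁻¹ * v k r = r⁻¹ * s⁻¹ * s⁻¹ := by
    rw [hwsr] at hk
    simp only [map_mul, hks, mul_inv_rev] at hk
    rw [hk]; group
  have hjr : v j r = (v k r)⁻¹ := by
    rw [← hv.mul k i j hik.symm hij hjk.symm, h2, map_inv]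
  have hkr2 : v k r = s * s * r⁻¹ * s⁻¹ * s⁻¹ := by
    calc v k r = s * s * (s⁻¹ * s⁻¹ * v k r) := by group
      _ = _ := by rw [hkr]; group
  rw [map_mul, map_mul, map_inv, hjs, hjr, hkr2]; group

omit [Finite G] in
theorem restrict {H : Subgroup G} (hH : Inv v H) :
    IsFour (fun i => ((v i).comp H.subtype).codRestrict H (fun x => hH i x x.2)) where
  sq i x := Subtype.ext (hv.sq i x)
  mul i j k h1 h2 h3 x := Subtype.ext (hv.mul i j k h1 h2 h3 x)
  fp x hx := Subtype.ext (hv.fp x (fun i => congrArg Subtype.val (hx i)))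

open scoped Pointwise in
theorem exists_sylow (p : ℕ) [Fact p.Prime] : ∃ P : Sylow p G, Inv v (P : Subgroup G) := by
  let eqv : Fin 3 → MulAut G := fun i =>
    { toFun := v i, invFun := v i, left_inv := hv.sq i, right_inv := hv.sq i
      map_mul' := map_mul (v i) }
  let f : Fin 3 → Sylow p G → Sylow p G := fun i P => eqv i • P
  have hmem : ∀ i (P : Sylow p G) x, x ∈ (f i P : Subgroup G) ↔ v i x ∈ (P : Subgroup G) := by
    intro i P x
    change x ∈ ((eqv i • P : Sylow p G) : Subgroup G) ↔ _
    change x ∈ (eqv i • (P : Subgroup G)) ↔ _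
    rw [Subgroup.mem_pointwise_smul_iff_inv_smul_mem]
    rfl
  have hodd : Odd (Nat.card (Sylow p G)) := by
    obtain ⟨P⟩ := (inferInstance : Nonempty (Sylow p G))
    have := P.card_dvd_index
    exact (hv.odd_card.of_dvd_nat (Subgroup.index_dvd_card (P : Subgroup G))).of_dvd_nat this
  obtain ⟨P, h0, h1⟩ := exists_common_fixed (f 0) (f 1)
    (fun P => Sylow.ext (by ext x; rw [hmem, hmem, hv.sq]))
    (fun P => Sylow.ext (by ext x; rw [hmem, hmem, hv.sq]))
    (fun P => Sylow.ext (by ext x; rw [hmem, hmem, hmem, hmem, hv.comm])) hodd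
  have g0 : ∀ x ∈ (P : Subgroup G), v 0 x ∈ (P : Subgroup G) := fun x hx => by
    rw [← hmem, h0]; exact hx
  have g1 : ∀ x ∈ (P : Subgroup G), v 1 x ∈ (P : Subgroup G) := fun x hx => by
    rw [← hmem, h1]; exact hx
  refine ⟨P, fun i x hx => ?_⟩
  fin_cases i
  · exact g0 x hx
  · exact g1 x hx
  · have := hv.mul 0 1 2 (by decide) (by decide) (by decide) x
    change v 2 x ∈ _
    rw [← this]; exact g0 _ (g1 _ hx)

end IsFour

namespace RL
variable {R : Type*} [Ring R]

structure Sys (S : Fin 3 → Set R) : Prop where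
  zero : ∀ i, (0 : R) ∈ S i
  s0 : ∀ i, ∀ a ∈ S i, ∀ b ∈ S i, ⁅a, b⁆ = 0
  s1 : ∀ i j k, i ≠ j → j ≠ k → i ≠ k → ∀ a ∈ S i, ∀ b ∈ S j, ⁅a, b⁆ ∈ S k

theorem zero_lie' (a : R) : ⁅(0 : R), a⁆ = 0 := by simp [Ring.lie_def]

theorem lie_zero' (a : R) : ⁅a, (0 : R)⁆ = 0 := by simp [Ring.lie_def]

theorem lie_skew' (a b : R) : -⁅b, a⁆ = ⁅a, b⁆ := by simp [Ring.lie_def]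

theorem neg_lie' (a b : R) : ⁅-a, b⁆ = -⁅a, b⁆ := by simp only [Ring.lie_def]; noncomm_ring

theorem jac (a b c : R) : ⁅⁅a, b⁆, c⁆ = ⁅⁅a, c⁆, b⁆ + ⁅a, ⁅b, c⁆⁆ := by
  simp only [Ring.lie_def]; noncomm_ring

theorem swap {y u x : R} (h : ⁅u, x⁆ = 0) : ⁅⁅y, u⁆, x⁆ = ⁅⁅y, x⁆, u⁆ := by
  rw [jac, h, lie_zero', add_zero]

def T (u u' y : R) : R := ⁅⁅y, u⁆, u'⁆

theorem T_zero (u u' : R) : T u u' 0 = 0 := by simp [T, zero_lie', neg_lie']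

theorem T_iter_zero (u u' : R) (k : ℕ) : (T u u')^[k] 0 = 0 := by
  induction k with
  | zero => rfl
  | succ k ih => rw [Function.iterate_succ_apply, T_zero, ih]

theorem T_comm {u u' x y : R} (h : ⁅u, x⁆ = 0) (h' : ⁅u', x⁆ = 0) :
    ⁅T u u' y, x⁆ = T u u' ⁅y, x⁆ := by
  rw [T, T, swap h', swap h]

theorem T_iter_comm {u u' x : R} (h : ⁅u, x⁆ = 0) (h' : ⁅u', x⁆ = 0) (k : ℕ) (y : R) :
    ⁅(T u u')^[k] y, x⁆ = (T u u')^[k] ⁅y, x⁆ := by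
  induction k generalizing y with
  | zero => rfl
  | succ k ih => rw [Function.iterate_succ_apply, Function.iterate_succ_apply, ih, T_comm h h']

variable {S : Fin 3 → Set R} (hS : Sys S)
include hS

theorem Sys.br {i j : Fin 3} {a b : R} (ha : a ∈ S i) (hb : b ∈ S j) : ∃ k, ⁅a, b⁆ ∈ S k := by
  by_cases h : i = j
  · subst h; exact ⟨i, by rw [hS.s0 i a ha b hb]; exact hS.zero i⟩
  · obtain ⟨k, h1, h2⟩ := third i j h
    exact ⟨k, hS.s1 i j k h h2 h1 a ha b hb⟩

/-- bracket with an element of the type `i` preserves being of type different from `i`. -/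
theorem Sys.br_ne {i j : Fin 3} (h : j ≠ i) {a b : R} (ha : a ∈ S j) (hb : b ∈ S i) :
    ∃ k, k ≠ i ∧ ⁅a, b⁆ ∈ S k := by
  obtain ⟨k, h1, h2⟩ := third j i h
  exact ⟨k, h2.symm, hS.s1 j i k h h2 h1 a ha b hb⟩

theorem Sys.T_mem {i j : Fin 3} (h : j ≠ i) {u u' y : R} (hu : u ∈ S i) (hu' : u' ∈ S i)
    (hy : y ∈ S j) : T u u' y ∈ S j := by
  obtain ⟨k, h1, h2⟩ := third j i h
  exact hS.s1 k i j h2.symm h.symm h1.symm _ (hS.s1 j i k h h2 h1 y hy u hu) _ hu'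

theorem Sys.T_iter_mem {i j : Fin 3} (h : j ≠ i) {u u' : R} (hu : u ∈ S i) (hu' : u' ∈ S i)
    (k : ℕ) {y : R} (hy : y ∈ S j) : (T u u')^[k] y ∈ S j := by
  induction k generalizing y with
  | zero => exact hy
  | succ k ih => rw [Function.iterate_succ_apply]; exact ih (hS.T_mem h hu hu' hy)

/-- `⁅T y, w⁆ = ⁅y, T w⁆` -/
theorem Sys.T_adj {i j l : Fin 3} (hj : j ≠ i) (hl : l ≠ i) (hjl : j ≠ l) {u u' y w : R}
    (hu : u ∈ S i) (hu' : u' ∈ S i) (hy : y ∈ S j) (hw : w ∈ S l) :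
    ⁅T u u' y, w⁆ = ⁅y, T u u' w⁆ := by
  have e1 : ⁅⁅y, u⁆, w⁆ = 0 := hS.s0 l _ (hS.s1 j i l hj hl.symm hjl y hy u hu) _ hw
  have e2 : ⁅y, ⁅w, u'⁆⁆ = 0 := hS.s0 j _ hy _ (hS.s1 l i j hl hj.symm hjl.symm w hw u' hu')
  have c : ⁅u, u'⁆ = 0 := hS.s0 i u hu u' hu'
  have a1 : ⁅T u u' y, w⁆ = - ⁅⁅y, u⁆, ⁅w, u'⁆⁆ := by
    have := jac ⁅y, u⁆ w u'
    rw [e1, zero_lie'] at this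
    rw [T]; exact eq_neg_of_add_eq_zero_left this.symm
  have a2 : ⁅y, ⁅⁅w, u'⁆, u⁆⁆ = - ⁅⁅y, u⁆, ⁅w, u'⁆⁆ := by
    have := jac y ⁅w, u'⁆ u
    rw [e2, zero_lie'] at this
    exact eq_neg_of_add_eq_zero_right this.symm
  rw [a1, ← a2, T, swap c]

theorem Sys.T_two {i j l m : Fin 3} (hj : j ≠ i) (hl : l ≠ i) (hm : m ≠ i) {u u' y w x : R}
    (hu : u ∈ S i) (hu' : u' ∈ S i) (hy : y ∈ S j) (hw : w ∈ S l) (hx : x ∈ S m) :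
    ⁅⁅T u u' y, w⁆, x⁆ = T u u' ⁅⁅y, w⁆, x⁆ := by
  by_cases hjl : j = l
  · subst hjl
    rw [hS.s0 j _ (hS.T_mem hj hu hu' hy) _ hw, hS.s0 j _ hy _ hw]
    simp [T, zero_lie', neg_lie']
  · have hcomm : ∀ z ∈ S i, ∀ y, ⁅T u u' y, z⁆ = T u u' ⁅y, z⁆ := fun z hz y =>
      T_comm (hS.s0 i _ hu _ hz) (hS.s0 i _ hu' _ hz)
    have hmc : m = j ∨ m = l := by
      rcases fin3_cases j l i hjl hl hj m with h | h | h
      · exact Or.inl h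
      · exact Or.inr h
      · exact absurd h hm
    rcases hmc with rfl | rfl
    · rw [jac (T u u' y) w x, hS.s0 m _ (hS.T_mem hj hu hu' hy) _ hx, zero_lie', zero_add,
        hcomm _ (hS.s1 l m i (Ne.symm hjl) hj hl w hw x hx), jac y w x, hS.s0 m _ hy _ hx,
        zero_lie', zero_add]
    · rw [hS.T_adj hj hl hjl hu hu' hy hw, jac y (T u u' w) x,
        hS.s0 m _ (hS.T_mem hl hu hu' hw) _ hx, lie_zero', add_zero,
        ← lie_skew', hcomm _ (hS.s1 j m i hjl hl hj y hy x hx), jac y w x,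
        hS.s0 m _ hw _ hx, lie_zero', add_zero, ← lie_skew' ⁅y, x⁆ w]
      simp [T, zero_lie', neg_lie']

theorem Sys.T_two_iter {i j l m : Fin 3} (hj : j ≠ i) (hl : l ≠ i) (hm : m ≠ i) {u u' w x : R}
    (hu : u ∈ S i) (hu' : u' ∈ S i) (hw : w ∈ S l) (hx : x ∈ S m) (k : ℕ)
    {y : R} (hy : y ∈ S j) :
    ⁅⁅(T u u')^[k] y, w⁆, x⁆ = (T u u')^[k] ⁅⁅y, w⁆, x⁆ := by
  induction k generalizing y with
  | zero => rfl
  | succ k ih =>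
    rw [Function.iterate_succ_apply, Function.iterate_succ_apply, ih (hS.T_mem hj hu hu' hy),
      hS.T_two hj hl hm hu hu' hy hw hx]

omit hS in
def Div (S : Fin 3 → Set R) (i : Fin 3) (u u' : R) (k : ℕ) (y : R) : Prop :=
  (∃ j, y ∈ S j) ∧ (k = 0 ∨ (∃ j y', j ≠ i ∧ y' ∈ S j ∧ y = (T u u')^[k] y') ∨
    ∃ j l y' w, j ≠ i ∧ l ≠ i ∧ y' ∈ S j ∧ w ∈ S l ∧ y = ⁅(T u u')^[k] y', w⁆)

theorem Sys.div_zero {i : Fin 3} (u u' : R) (k : ℕ) : Div S i u u' k 0 := by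
  obtain ⟨j, hj⟩ : ∃ j, j ≠ i := (by decide : ∀ i : Fin 3, ∃ j, j ≠ i) i
  exact ⟨⟨j, hS.zero j⟩, Or.inr (Or.inl ⟨j, 0, hj, hS.zero j, by rw [T_iter_zero]⟩)⟩

/-- `⁅⁅y,w⁆,x⁆` is of type different from `i`. -/
theorem Sys.two_mem {i j l m : Fin 3} (hj : j ≠ i) (hl : l ≠ i) (hm : m ≠ i) {y w x : R}
    (hy : y ∈ S j) (hw : w ∈ S l) (hx : x ∈ S m) : ∃ a, a ≠ i ∧ ⁅⁅y, w⁆, x⁆ ∈ S a := by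
  by_cases hjl : j = l
  · subst hjl
    rw [hS.s0 j _ hy _ hw, zero_lie']; exact ⟨j, hj, hS.zero j⟩
  · have h1 := hS.s1 j l i hjl hl hj y hy w hw
    obtain ⟨k, h2, h3⟩ := third i m hm.symm
    exact ⟨k, h2.symm, hS.s1 i m k hm.symm h3 h2 _ h1 x hx⟩

theorem Sys.div_br {i m : Fin 3} {u u' y z : R} (hu : u ∈ S i) (hu' : u' ∈ S i) {k : ℕ}
    (hy : Div S i u u' k y) (hz : z ∈ S m) : Div S i u u' k ⁅y, z⁆ := by
  obtain ⟨⟨t, ht⟩, h⟩ := hy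
  have hb := hS.br ht hz
  refine ⟨hb, ?_⟩
  rcases h with h | ⟨j, y', hj, hy', rfl⟩ | ⟨j, l, y', w, hj, hl, hy', hw, rfl⟩
  · exact Or.inl h
  · right
    by_cases hm : m = i
    · subst hm
      left
      obtain ⟨a, ha, ha'⟩ := hS.br_ne hj hy' hz
      exact ⟨a, _, ha, ha', T_iter_comm (hS.s0 _ _ hu _ hz) (hS.s0 _ _ hu' _ hz) k y'⟩
    · right
      exact ⟨j, m, y', z, hj, hm, hy', hz, rfl⟩
  · right; left
    by_cases hm : m = i
    · subst hm
      have : ⁅⁅(T u u')^[k] y', w⁆, z⁆ = 0 := by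
        by_cases hjl : j = l
        · subst hjl
          rw [hS.s0 j _ (hS.T_iter_mem hj hu hu' k hy') _ hw, zero_lie']
        · exact hS.s0 m _ (hS.s1 j l m hjl hl hj _ (hS.T_iter_mem hj hu hu' k hy') _ hw) _ hz
      exact ⟨j, 0, hj, hS.zero j, by rw [this, T_iter_zero]⟩
    · obtain ⟨a, ha, ha'⟩ := hS.two_mem hj hl hm hy' hw hz
      exact ⟨a, _, ha, ha', hS.T_two_iter hj hl hm hu hu' hw hz k hy'⟩

theorem Sys.div_T {i : Fin 3} {u u' y : R} (hu : u ∈ S i) (hu' : u' ∈ S i) {k : ℕ}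
    (hy : Div S i u u' k y) : Div S i u u' (k + 1) (T u u' y) := by
  obtain ⟨⟨t, ht⟩, h⟩ := hy
  by_cases hti : t = i
  · subst hti
    have : T u u' y = 0 := by rw [T, hS.s0 t _ ht _ hu, zero_lie']
    rw [this]; exact hS.div_zero u u' _
  refine ⟨⟨t, hS.T_mem hti hu hu' ht⟩, Or.inr ?_⟩
  rcases h with h | ⟨j, y', hj, hy', rfl⟩ | ⟨j, l, y', w, hj, hl, hy', hw, h⟩
  · subst h
    exact Or.inl ⟨t, y, hti, ht, rfl⟩
  · exact Or.inl ⟨j, y', hj, hy', by rw [Function.iterate_succ_apply']⟩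
  · have : T u u' y = 0 := by
      by_cases hjl : j = l
      · subst hjl
        rw [h, hS.s0 j _ (hS.T_iter_mem hj hu hu' k hy') _ hw, T_zero]
      · have := hS.s1 j l i hjl hl hj _ (hS.T_iter_mem hj hu hu' k hy') _ hw
        rw [← h] at this
        rw [T, hS.s0 i _ this _ hu, zero_lie']
    exact Or.inl ⟨t, 0, hti, hS.zero t, by rw [this, T_iter_zero]⟩

/-- main block lemma -/
theorem Sys.block {a b c : Fin 3} {u w z : R} (hu : u ∈ S a) (hw : w ∈ S b) (hz : z ∈ S c) :
    ∃ i p q, p ∈ S i ∧ q ∈ S i ∧ (p = u ∨ p = w) ∧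
      ∀ k y, Div S i p q k y → Div S i p q (k + 1) ⁅⁅⁅y, u⁆, w⁆, z⁆ := by
  by_cases hab : a = b
  · subst hab
    refine ⟨a, u, w, hu, hw, Or.inl rfl, fun k y hy => ?_⟩
    exact hS.div_br hu hw (hS.div_T hu hw hy) hz
  by_cases hbc : b = c
  · subst hbc
    refine ⟨b, w, z, hw, hz, Or.inr rfl, fun k y hy => ?_⟩
    exact hS.div_T hw hz (hS.div_br hw hz hy hu)
  by_cases hac : a = c
  · subst hac
    refine ⟨a, u, z, hu, hz, Or.inl rfl, fun k y hy => ?_⟩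
    have : ⁅⁅⁅y, u⁆, w⁆, z⁆ = 0 := by
      obtain ⟨⟨t, ht⟩, -⟩ := hy
      obtain ⟨d, had, hbd⟩ := third a b hab
      rcases fin3_cases a b d hab hbd had t with rfl | rfl | rfl
      · rw [hS.s0 t _ ht _ hu]; simp [zero_lie']
      · have h1 := hS.s1 t a d (Ne.symm hab) had hbd y ht u hu
        have h2 := hS.s1 d t a hbd.symm (Ne.symm hab) had.symm _ h1 w hw
        exact hS.s0 a _ h2 _ hz
      · have h1 := hS.s1 t a b had.symm hab hbd.symm y ht u hu
        rw [hS.s0 b _ h1 _ hw, zero_lie']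
    rw [this]; exact hS.div_zero _ _ _
  · have hwz := hS.s1 b c a hbc (Ne.symm hac) (Ne.symm hab) w hw z hz
    refine ⟨a, u, ⁅w, z⁆, hu, hwz, Or.inl rfl, fun k y hy => ?_⟩
    obtain ⟨⟨t, ht⟩, -⟩ := id hy
    rcases fin3_cases a b c hab hbc hac t with rfl | rfl | rfl
    · rw [hS.s0 t _ ht _ hu]; simpa [zero_lie'] using hS.div_zero _ _ _
    · have h1 := hS.s1 t a c (Ne.symm hab) hac hbc y ht u hu
      have : ⁅⁅⁅y, u⁆, w⁆, z⁆ = T u ⁅w, z⁆ y := by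
        rw [jac, hS.s0 c _ h1 _ hz, zero_lie', zero_add, T]
      rw [this]; exact hS.div_T hu hwz hy
    · have h1 := hS.s1 t a b (Ne.symm hac) hab (Ne.symm hbc) y ht u hu
      rw [hS.s0 b _ h1 _ hw, zero_lie']; exact hS.div_zero _ _ _

omit hS in
theorem ad_iter_nil {u : R} {n : ℕ} (hu : u ^ n = 0) (y : R) :
    (fun z => ⁅z, u⁆)^[2 * n] y = 0 := by
  have key : ∀ k : ℕ, (fun z : R => ⁅z, u⁆)^[k] y
      = ((LinearMap.mulRight ℤ u - LinearMap.mulLeft ℤ u) ^ k) y := by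
    intro k
    induction k with
    | zero => rfl
    | succ k ih =>
      rw [Function.iterate_succ_apply', ih, pow_succ', Module.End.mul_apply]
      rfl
  rw [key]
  have hc : Commute (LinearMap.mulRight ℤ u) (LinearMap.mulLeft ℤ u) :=
    (LinearMap.commute_mulLeft_right (R := ℤ) u u).symm
  have h1 : (LinearMap.mulRight ℤ u) ^ n = 0 := by
    rw [LinearMap.pow_mulRight, hu]; simp [zero_lie']
  have h2 : (LinearMap.mulLeft ℤ u) ^ n = 0 := by
    rw [LinearMap.pow_mulLeft, hu]; simp [zero_lie']
  have h3 : (-(LinearMap.mulLeft ℤ u)) ^ n = 0 := by rw [neg_pow, h2, mul_zero]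
  have : (LinearMap.mulRight ℤ u - LinearMap.mulLeft ℤ u) ^ (2 * n) = 0 := by
    rw [sub_eq_add_neg]
    exact hc.neg_right.add_pow_eq_zero_of_add_le_succ_of_pow_eq_zero h1 h3 (by omega)
  rw [this]; rfl

omit hS in
theorem T_iter_nil {u u' : R} {n : ℕ} (hc : ⁅u, u'⁆ = 0) (hu : u ^ n = 0) (y : R) :
    (T u u')^[2 * n] y = 0 := by
  have key : ∀ k : ℕ, ∀ y, (T u u')^[k] y = (fun z => ⁅z, u'⁆)^[k] ((fun z => ⁅z, u⁆)^[k] y) := by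
    have sw : Function.Commute (fun z : R => ⁅z, u⁆) (fun z : R => ⁅z, u'⁆) := by
      intro z
      have hc' : ⁅u', u⁆ = 0 := by rw [← lie_skew', hc, neg_zero]
      exact swap hc'
    intro k y
    have : T u u' = (fun z : R => ⁅z, u'⁆) ∘ (fun z : R => ⁅z, u⁆) := by funext z; rfl
    rw [this, sw.symm.comp_iterate]; rfl
  rw [key, ad_iter_nil hu]
  generalize 2 * n = k
  induction k with
  | zero => rfl
  | succ k ih => rw [Function.iterate_succ_apply, zero_lie', ih]

theorem Sys.div_nil {i : Fin 3} {u u' y : R} (hu : u ∈ S i) (hu' : u' ∈ S i) {n k : ℕ}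
    (hn : 0 < n) (hun : u ^ n = 0) (hk : 2 * n ≤ k) (hy : Div S i u u' k y) : y = 0 := by
  have h0 : ∀ y', (T u u')^[k] y' = 0 := by
    intro y'
    obtain ⟨d, rfl⟩ := Nat.exists_eq_add_of_le hk
    rw [add_comm, Function.iterate_add_apply, T_iter_nil (hS.s0 i _ hu _ hu') hun, T_iter_zero]
  rcases hy.2 with h | ⟨j, y', -, -, rfl⟩ | ⟨j, l, y', w, -, -, -, -, rfl⟩
  · omega
  · exact h0 _
  · rw [h0, zero_lie']

omit hS in
/-- left-normed commutators -/
def lc {ι : Type*} (x : ι → R) (y : R) (l : List ι) : R := l.foldl (fun y i => ⁅y, x i⁆) y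

omit hS in
def blocks {ι : Type*} : List ι → List (ι × ι × ι)
  | a :: b :: c :: t => (a, b, c) :: blocks t
  | _ => []

omit hS in
theorem blocks_length {ι : Type*} : ∀ l : List ι, (blocks l).length = l.length / 3
  | a :: b :: c :: t => by
    simp only [blocks, List.length_cons, blocks_length t]; omega
  | [] => by simp [blocks]
  | [_] => by simp [blocks]
  | [_, _] => by simp [blocks]

theorem Sys.lc_mem {ι : Type*} {x : ι → R} (hx : ∀ i, ∃ j, x i ∈ S j) {y : R}
    (hy : ∃ j, y ∈ S j) (l : List ι) : ∃ j, lc x y l ∈ S j := by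
  induction l generalizing y with
  | nil => exact hy
  | cons a l ih =>
    obtain ⟨j, hj⟩ := hy
    obtain ⟨m, hm⟩ := hx a
    exact ih (hS.br hj hm)

theorem Sys.lc_div {ι : Type*} [DecidableEq ι] {x : ι → R} (hx : ∀ i, ∃ j, x i ∈ S j)
    (β : ι × ι × ι) {i : Fin 3} {u u' : R} (hu : u ∈ S i) (hu' : u' ∈ S i)
    (hT : ∀ k y, Div S i u u' k y → Div S i u u' (k + 1) ⁅⁅⁅y, x β.1⁆, x β.2.1⁆, x β.2.2⁆) :
    ∀ (l : List ι) (k : ℕ) (y : R), Div S i u u' k y →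
      Div S i u u' (k + (blocks l).count β) (lc x y l)
  | a :: b :: c :: t, k, y, hy => by
    obtain ⟨ja, ha⟩ := hx a
    obtain ⟨jb, hb⟩ := hx b
    obtain ⟨jc, hc⟩ := hx c
    have e : lc x y (a :: b :: c :: t) = lc x ⁅⁅⁅y, x a⁆, x b⁆, x c⁆ t := rfl
    rw [e, blocks, List.count_cons]
    by_cases h : (a, b, c) = β
    · subst h
      have := Sys.lc_div hx (a, b, c) hu hu' hT t (k + 1) _ (hT k y hy)
      simp only [BEq.rfl, if_true]
      rw [add_assoc, add_comm 1] at this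
      exact this
    · have h' : ((a, b, c) == β) = false := by simpa using h
      rw [h']
      exact Sys.lc_div hx β hu hu' hT t k _
        (hS.div_br hu hu' (hS.div_br hu hu' (hS.div_br hu hu' hy ha) hb) hc)
  | [], k, y, hy => hy
  | [a], k, y, hy => by
    obtain ⟨ja, ha⟩ := hx a
    exact hS.div_br hu hu' hy ha
  | [a, b], k, y, hy => by
    obtain ⟨ja, ha⟩ := hx a
    obtain ⟨jb, hb⟩ := hx b
    exact hS.div_br hu hu' (hS.div_br hu hu' hy ha) hb

omit hS in
theorem exists_count {α : Type*} [Fintype α] [DecidableEq α] [Nonempty α] (l : List α) (n : ℕ)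
    (h : Fintype.card α * n ≤ l.length) : ∃ β, n ≤ l.count β := by
  by_contra! hcon
  have h1 := Finset.sum_lt_sum_of_nonempty (s := (Finset.univ : Finset α))
    Finset.univ_nonempty (fun β _ => hcon β)
  have h2 : ∑ β, l.count β = l.length := by
    have := Multiset.sum_count_eq_card (s := Finset.univ)
      (m := (↑l : Multiset α)) (fun a _ => Finset.mem_univ a)
    simpa only [Multiset.coe_count, Multiset.coe_card] using this
  rw [h2, Finset.sum_const, smul_eq_mul, Finset.card_univ] at h1
  omega

theorem Sys.lc_nil {x : Fin 3 → R} (hx : ∀ i, ∃ j, x i ∈ S j) {n : ℕ} (hn : 0 < n)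
    (hxn : ∀ i, x i ^ n = 0) {y : R} (hy : ∃ j, y ∈ S j) (l : List (Fin 3))
    (hl : 162 * n ≤ l.length) : lc x y l = 0 := by
  have hcard : Fintype.card (Fin 3 × Fin 3 × Fin 3) = 27 := by
    simp only [Fintype.card_prod, Fintype.card_fin]
  have : ∃ β, 2 * n ≤ (blocks l).count β := by
    have h := exists_count (blocks l) (2 * n) (by rw [blocks_length, hcard]; omega)
    convert h using 3
    congr 1
    exact lawful_beq_subsingleton _ _
  obtain ⟨β, hβ⟩ := this
  obtain ⟨a, ha⟩ := hx β.1
  obtain ⟨b, hb⟩ := hx β.2.1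
  obtain ⟨c, hc⟩ := hx β.2.2
  obtain ⟨i, p, q, hp, hq, hpu, hT⟩ := hS.block ha hb hc
  have hpn : p ^ n = 0 := by rcases hpu with rfl | rfl <;> exact hxn _
  have := hS.lc_div hx β hp hq hT l 0 y ⟨hy, Or.inl rfl⟩
  exact hS.div_nil hp hq hn hpn (by omega) this

end RL

namespace RL
variable {R : Type*} [Ring R]

abbrev Idx (n : ℕ) : Type := Fin 3 × {l : List (Fin 3) // l.length < 162 * n}

instance (n : ℕ) : Finite (Idx n) := by
  have : Finite {l : List (Fin 3) // l.length < 162 * n} := (List.finite_length_lt (Fin 3) _).to_subtype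
  infer_instance

def ell (x : Fin 3 → R) {n : ℕ} (w : Idx n) : R := lc x (x w.1) w.2.1

def LL (x : Fin 3 → R) (n : ℕ) : AddSubgroup R := AddSubgroup.closure (Set.range (ell x (n := n)))

theorem lc_concat (x : Fin 3 → R) (y : R) (l : List (Fin 3)) (j : Fin 3) :
    lc x y (l ++ [j]) = ⁅lc x y l, x j⁆ := by simp [lc]

theorem sub_lie' (a b c : R) : ⁅a - b, c⁆ = ⁅a, c⁆ - ⁅b, c⁆ := by
  simp only [Ring.lie_def]; noncomm_ring

theorem add_lie' (a b c : R) : ⁅a + b, c⁆ = ⁅a, c⁆ + ⁅b, c⁆ := by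
  simp only [Ring.lie_def]; noncomm_ring

theorem LL_br {x : Fin 3 → R} {n : ℕ} (h : ∀ i (l : List (Fin 3)), lc x (x i) l ∈ LL x n)
    {u : R} (hu : u ∈ LL x n) (i : Fin 3) (l : List (Fin 3)) : ⁅u, lc x (x i) l⁆ ∈ LL x n := by
  have h1 : ∀ u ∈ LL x n, ∀ j, ⁅u, x j⁆ ∈ LL x n := by
    intro u hu j
    induction hu using AddSubgroup.closure_induction with
    | mem y hy =>
      obtain ⟨w, rfl⟩ := hy
      rw [ell, ← lc_concat]; exact h _ _
    | zero => rw [zero_lie']; exact zero_mem _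
    | add a b _ _ ha hb => rw [add_lie']; exact add_mem ha hb
    | neg a _ ha => rw [neg_lie']; exact neg_mem ha
  induction l using List.reverseRecOn generalizing u with
  | nil => exact h1 u hu i
  | append_singleton l j ih =>
    rw [lc_concat]
    have := jac u (lc x (x i) l) (x j)
    rw [← sub_eq_iff_eq_add'] at this
    rw [← this]
    exact sub_mem (h1 _ (ih hu) j) (ih (h1 _ hu j))

def pr (x : Fin 3 → R) {n : ℕ} (t : List (Idx n)) : R := (t.map (ell x)).prod

def PP (x : Fin 3 → R) (n m : ℕ) : AddSubgroup R :=
  AddSubgroup.closure {r | ∃ t : List (Idx n), t.length ≤ m ∧ r = pr x t}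

theorem pr_mem {x : Fin 3 → R} {n m : ℕ} {t : List (Idx n)} (h : t.length ≤ m) :
    pr x t ∈ PP x n m := AddSubgroup.subset_closure ⟨t, h, rfl⟩

theorem PP_mul {x : Fin 3 → R} {n m : ℕ} (a : Idx n) {r : R} (hr : r ∈ PP x n m) :
    ell x a * r ∈ PP x n (m + 1) := by
  induction hr using AddSubgroup.closure_induction with
  | mem y hy =>
    obtain ⟨t, ht, rfl⟩ := hy
    exact AddSubgroup.subset_closure ⟨a :: t, by simpa using ht, by simp [pr]⟩
  | zero => rw [mul_zero]; exact zero_mem _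
  | add a b _ _ ha hb => rw [mul_add]; exact add_mem ha hb
  | neg a _ ha => rw [mul_neg]; exact neg_mem ha

theorem LL_mul {x : Fin 3 → R} {n m : ℕ} {u : R} (hu : u ∈ LL x n) {t : List (Idx n)}
    (ht : t.length < m) : u * pr x t ∈ PP x n m := by
  induction hu using AddSubgroup.closure_induction with
  | mem y hy =>
    obtain ⟨w, rfl⟩ := hy
    exact AddSubgroup.subset_closure ⟨w :: t, by simpa using ht, by simp [pr]⟩
  | zero => rw [zero_mul]; exact zero_mem _
  | add a b _ _ ha hb => rw [add_mul]; exact add_mem ha hb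
  | neg a _ ha => rw [neg_mul]; exact neg_mem ha

theorem pr_perm {x : Fin 3 → R} {n : ℕ} (h : ∀ i (l : List (Fin 3)), lc x (x i) l ∈ LL x n)
    {t t' : List (Idx n)} (hp : t.Perm t') : ∀ m, t.length ≤ m + 1 →
    pr x t - pr x t' ∈ PP x n m := by
  induction hp with
  | nil => intro m _; rw [sub_self]; exact zero_mem _
  | cons a hp ih =>
    intro m hm
    rcases m with _ | m
    · have h1 : ∀ {l : List (Idx n)}, l.length ≤ 0 → l = [] := by
        intro l hl; exact List.eq_nil_of_length_eq_zero (by omega)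
      have e1 := h1 (l := _) (by simpa using hm)
      subst e1
      have := hp.nil_eq
      subst this
      rw [sub_self]; exact zero_mem _
    · have := PP_mul a (ih m (by simpa using hm))
      rw [mul_sub] at this
      simpa [pr] using this
  | swap a b t =>
    intro m hm
    have : pr x (b :: a :: t) - pr x (a :: b :: t) = ⁅ell x b, ell x a⁆ * pr x t := by
      simp only [pr, List.map_cons, List.prod_cons, Ring.lie_def]; noncomm_ring
    rw [this]
    refine LL_mul ?_ (by simp at hm; omega)
    exact LL_br h (AddSubgroup.subset_closure ⟨b, rfl⟩) _ _
  | trans h1 h2 ih1 ih2 =>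
    intro m hm
    have := add_mem (ih1 m hm) (ih2 m (by rw [← h1.length_eq]; exact hm))
    simpa using this

theorem pr_flatMap (x : Fin 3 → R) {n : ℕ} (E : List (Idx n)) (k : Idx n → ℕ) :
    pr x (E.flatMap (fun i => List.replicate (k i) i)) = (E.map (fun i => ell x i ^ k i)).prod := by
  induction E with
  | nil => simp [pr]
  | cons a E ih =>
    simp only [pr, List.flatMap_cons, List.map_append, List.prod_append, List.map_cons,
      List.prod_cons, List.map_replicate, List.prod_replicate] at ih ⊢
    rw [ih]

theorem perm_flatMap {α : Type*} [DecidableEq α] (E t : List α) (hE : E.Nodup) (hE' : ∀ a, a ∈ E) :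
    t.Perm (E.flatMap (fun i => List.replicate (t.count i) i)) := by
  rw [List.perm_iff_count]
  intro a
  rw [List.count_flatMap]
  have h1 : (List.map (List.count a ∘ fun i => List.replicate (List.count i t) i) E)
      = E.map (fun i => if i = a then t.count a else 0) := by
    apply List.map_congr_left
    intro i _
    simp only [Function.comp, List.count_replicate]
    by_cases h : i = a
    · subst h; simp
    · simp [h]
  rw [h1]
  have h2 : ∀ c : ℕ, ∀ F : List α, (F.map (fun i => if i = a then c else 0)).sum
      = F.count a * c := by
    intro c F
    induction F with
    | nil => simp
    | cons d F ih =>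
      rw [List.map_cons, List.sum_cons, ih, List.count_cons]
      by_cases h : d = a
      · simp [h]; ring
      · simp [h]
  rw [h2, List.count_eq_one_of_mem hE (hE' a), one_mul]

variable {S : Fin 3 → Set R} (hS : Sys S)
include hS

theorem Sys.span {x : Fin 3 → R} (hx : ∀ i, ∃ j, x i ∈ S j) {n : ℕ} (hn : 0 < n)
    (hxn : ∀ i, x i ^ n = 0) (hs0 : ∀ a ∈ S 0, a ^ n = 0) (hs1 : ∀ a ∈ S 1, a ^ n = 0) :
    ∃ b : (Idx n → Fin n) → R, (∀ k, b k ∈ Submonoid.closure (⋃ j, S j)) ∧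
      ∀ s : List (Fin 3), (s.map x).prod ∈
        AddSubgroup.closure (Set.range b) ⊔ (Submodule.span R (S 2)).toAddSubgroup := by
  classical
  have := Fintype.ofFinite (Idx n)
  have hell : ∀ w : Idx n, ∃ j, ell x w ∈ S j := fun w => hS.lc_mem hx (hx _) _
  have hlc : ∀ i (l : List (Fin 3)), lc x (x i) l ∈ LL x n := by
    intro i l
    by_cases hl : l.length < 162 * n
    · exact AddSubgroup.subset_closure ⟨(i, ⟨l, hl⟩), rfl⟩
    · rw [hS.lc_nil hx hn hxn (hx i) l (by omega)]; exact zero_mem _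
  set E1 : List (Idx n) := (Finset.univ.filter (fun w => ell x w ∉ S 2)).toList with hE1
  set E2 : List (Idx n) := (Finset.univ.filter (fun w => ell x w ∈ S 2)).toList with hE2
  have hnil : ∀ w ∈ E1, ell x w ^ n = 0 := by
    intro w hw
    have hw2 : ell x w ∉ S 2 := by simpa [hE1] using hw
    obtain ⟨j, hj⟩ := hell w
    fin_cases j
    · exact hs0 _ hj
    · exact hs1 _ hj
    · exact absurd hj hw2
  have hnd : (E1 ++ E2).Nodup := by
    rw [List.nodup_append]
    refine ⟨Finset.nodup_toList _, Finset.nodup_toList _, ?_⟩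
    intro a ha b hb hab
    subst hab
    have h1 : ell x a ∉ S 2 := by simpa [hE1] using ha
    have h2 : ell x a ∈ S 2 := by simpa [hE2] using hb
    exact h1 h2
  have hall : ∀ a, a ∈ E1 ++ E2 := by
    intro a
    by_cases h : ell x a ∈ S 2
    · simp [hE1, hE2, h]
    · simp [hE1, hE2, h]
  let b : (Idx n → Fin n) → R := fun k => (E1.map (fun i => ell x i ^ (k i : ℕ))).prod
  set M := AddSubgroup.closure (Set.range b) ⊔ (Submodule.span R (S 2)).toAddSubgroup with hM
  have hJ : ∀ r ∈ Submodule.span R (S 2), r ∈ M := fun r hr =>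
    (le_sup_right : _ ≤ M) hr
  -- normal form
  have hE2J : ∀ (k : Idx n → ℕ) (E : List (Idx n)), (∀ w ∈ E, ell x w ∈ S 2) →
      (E.map (fun i => ell x i ^ k i)).prod = 1 ∨
      (E.map (fun i => ell x i ^ k i)).prod ∈ Submodule.span R (S 2) := by
    intro k E hE
    induction E with
    | nil => left; rfl
    | cons a E ih =>
      rw [List.map_cons, List.prod_cons]
      rcases ih (fun w hw => hE w (List.mem_cons_of_mem _ hw)) with h | h
      · rw [h, mul_one]
        rcases hk : k a with _ | m
        · left; rw [pow_zero]
        · right; rw [pow_succ]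
          exact Submodule.smul_mem _ _ (Submodule.subset_span (hE a List.mem_cons_self))
      · right; exact Submodule.smul_mem _ _ h
  have hE1z : ∀ (k : Idx n → ℕ) (E : List (Idx n)), (∀ w ∈ E, ell x w ^ n = 0) →
      (∃ w ∈ E, n ≤ k w) → (E.map (fun i => ell x i ^ k i)).prod = 0 := by
    intro k E hE ⟨w, hw, hk⟩
    obtain ⟨s, t, rfl⟩ := List.append_of_mem hw
    have : ell x w ^ k w = 0 := pow_eq_zero_of_le hk (hE w hw)
    simp [this]
  have hnf : ∀ k : Idx n → ℕ, ((E1 ++ E2).map (fun i => ell x i ^ k i)).prod ∈ M := by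
    intro k
    rw [List.map_append, List.prod_append]
    rcases hE2J k E2 (fun w hw => by simpa [hE2] using hw) with h | h
    · rw [h, mul_one]
      by_cases hz : ∃ w ∈ E1, n ≤ k w
      · rw [hE1z k E1 hnil hz]; exact zero_mem _
      · push Not at hz
        refine (le_sup_left : _ ≤ M) (AddSubgroup.subset_closure
          ⟨fun w => ⟨if k w < n then k w else 0, by split_ifs <;> omega⟩, ?_⟩)
        change (E1.map _).prod = _
        congr 1
        apply List.map_congr_left
        intro w hw
        simp [hz w hw]
    · exact hJ _ (Submodule.smul_mem _ _ h)
  have hP : ∀ m, PP x n m ≤ M := by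
    intro m
    induction m with
    | zero =>
      rw [PP, AddSubgroup.closure_le]
      rintro r ⟨t, ht, rfl⟩
      have : t = [] := List.eq_nil_of_length_eq_zero (by omega)
      subst this
      have := hnf (fun _ => 0)
      simpa [pr] using this
    | succ m ih =>
      rw [PP, AddSubgroup.closure_le]
      rintro r ⟨t, ht, rfl⟩
      obtain ⟨k, hk⟩ : ∃ k : Idx n → ℕ,
          t.Perm ((E1 ++ E2).flatMap (fun i => List.replicate (k i) i)) :=
        ⟨_, perm_flatMap (E1 ++ E2) t hnd hall⟩
      have h1 := ih (pr_perm hlc hk m ht)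
      have h2 := hnf k
      rw [← pr_flatMap] at h2
      have := add_mem h1 h2
      simpa using this
  refine ⟨b, ?_, ?_⟩
  · intro k
    apply Submonoid.list_prod_mem
    intro r hr
    obtain ⟨w, -, rfl⟩ := List.mem_map.1 hr
    apply Submonoid.pow_mem
    obtain ⟨j, hj⟩ := hell w
    exact Submonoid.subset_closure (Set.mem_iUnion.2 ⟨j, hj⟩)
  · intro s
    have := hP s.length (pr_mem (t := s.map (fun i => ((i, ⟨[], by simp; omega⟩) : Idx n))) (by simp))
    have e : pr x (s.map (fun i => ((i, ⟨[], by simp; omega⟩) : Idx n))) = (s.map x).prod := by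
      rw [pr, List.map_map]; rfl
    rwa [e] at this

end RL

section
open Polynomial

structure Filt {A : Type*} [Ring A] (F : ℕ → AddSubgroup A) : Prop where
  zero_eq : F 0 = ⊤
  anti : ∀ n, F (n + 1) ≤ F n
  mul : ∀ m n a b, a ∈ F m → b ∈ F n → a * b ∈ F (m + n)

namespace Filt
variable {A : Type*} [Ring A] {F : ℕ → AddSubgroup A} (hF : Filt F)
include hF

theorem antitone : Antitone F := antitone_nat_of_succ_le hF.anti

def rees : Subring A[X] where
  carrier := {f | ∀ n, f.coeff n ∈ F n}
  mul_mem' := by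
    intro f g hf hg n
    rw [coeff_mul]
    apply AddSubgroup.sum_mem
    intro c hc
    rw [← Finset.HasAntidiagonal.mem_antidiagonal.1 hc]
    exact hF.mul _ _ _ _ (hf _) (hg _)
  one_mem' := by
    intro n
    rw [coeff_one]
    split_ifs with h
    · rw [h, hF.zero_eq]; trivial
    · exact zero_mem _
  add_mem' := by intro f g hf hg n; rw [coeff_add]; exact add_mem (hf n) (hg n)
  zero_mem' := by intro n; rw [coeff_zero]; exact zero_mem _
  neg_mem' := by intro f hf n; rw [coeff_neg]; exact neg_mem (hf n)

def K : Ideal hF.rees where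
  carrier := {f | ∀ n, f.1.coeff n ∈ F (n + 1)}
  add_mem' := by intro f g hf hg n; rw [Subring.coe_add, coeff_add]; exact add_mem (hf n) (hg n)
  zero_mem' := by intro n; exact zero_mem _
  smul_mem' := by
    intro f g hg n
    rw [smul_eq_mul, Subring.coe_mul, coeff_mul]
    apply AddSubgroup.sum_mem
    intro c hc
    rw [← Finset.HasAntidiagonal.mem_antidiagonal.1 hc, add_assoc]
    exact hF.mul _ _ _ _ (f.2 _) (hg _)

instance : (hF.K).IsTwoSided where
  mul_mem_of_left := by
    intro f g hf n
    rw [Subring.coe_mul, coeff_mul]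
    apply AddSubgroup.sum_mem
    intro c hc
    rw [← Finset.HasAntidiagonal.mem_antidiagonal.1 hc, add_right_comm]
    exact hF.mul _ _ _ _ (hf _) (g.2 _)

abbrev gr : Type _ := hF.rees ⧸ hF.K

theorem mono_mem {n : ℕ} {a : A} (ha : a ∈ F n) : monomial n a ∈ hF.rees := by
  intro m
  rw [coeff_monomial]
  split_ifs with h
  · rw [← h]; exact ha
  · exact zero_mem _

noncomputable def sg (n : ℕ) (a : A) (ha : a ∈ F n) : hF.gr := Ideal.Quotient.mk hF.K ⟨monomial n a, hF.mono_mem ha⟩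

theorem sg_eq_zero {n : ℕ} {a : A} (ha : a ∈ F n) : hF.sg n a ha = 0 ↔ a ∈ F (n + 1) := by
  rw [sg, Ideal.Quotient.eq_zero_iff_mem]
  constructor
  · intro h
    have := h n
    simpa using this
  · intro h m
    change (monomial n a).coeff m ∈ _
    rw [coeff_monomial]
    split_ifs with h'
    · rw [← h']; exact h
    · exact zero_mem _

theorem sg_add {n : ℕ} {a b : A} (ha : a ∈ F n) (hb : b ∈ F n) :
    hF.sg n a ha + hF.sg n b hb = hF.sg n (a + b) (add_mem ha hb) := by
  rw [sg, sg, sg, ← map_add]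
  congr 1
  exact Subtype.ext (by simp)

theorem sg_sub {n : ℕ} {a b : A} (ha : a ∈ F n) (hb : b ∈ F n) :
    hF.sg n a ha - hF.sg n b hb = hF.sg n (a - b) (sub_mem ha hb) := by
  rw [sg, sg, sg, ← map_sub]
  congr 1
  exact Subtype.ext (by simp)

theorem sg_mul {m n : ℕ} {a b : A} (ha : a ∈ F m) (hb : b ∈ F n) :
    hF.sg m a ha * hF.sg n b hb = hF.sg (m + n) (a * b) (hF.mul _ _ _ _ ha hb) := by
  rw [sg, sg, sg, ← map_mul]
  congr 1
  exact Subtype.ext (by simp [monomial_mul_monomial])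

theorem sg_congr {m n : ℕ} {a b : A} (ha : a ∈ F m) (hb : b ∈ F n) (h : m = n) (hab : a = b) :
    hF.sg m a ha = hF.sg n b hb := by subst h; subst hab; rfl

theorem sg_eq {n : ℕ} {a b : A} (ha : a ∈ F n) (hb : b ∈ F n) (hab : a - b ∈ F (n + 1)) :
    hF.sg n a ha = hF.sg n b hb := by
  rw [← sub_eq_zero, hF.sg_sub, hF.sg_eq_zero]; exact hab

theorem sg_one (h : (1 : A) ∈ F 0) : hF.sg 0 1 h = 1 := by
  rw [sg, ← map_one (Ideal.Quotient.mk hF.K)]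
  congr 1

theorem sg_pow {m : ℕ} {a : A} (ha : a ∈ F m) (k : ℕ) :
    ∃ h, hF.sg m a ha ^ k = hF.sg (m * k) (a ^ k) h := by
  induction k with
  | zero =>
    have h1 : (1 : A) ∈ F 0 := by rw [hF.zero_eq]; trivial
    refine ⟨by simpa using h1, ?_⟩
    rw [pow_zero, ← hF.sg_one h1]
    exact hF.sg_congr _ _ (by simp) (by simp)
  | succ k ih =>
    obtain ⟨h, e⟩ := ih
    have h2 := hF.mul _ _ _ _ h ha
    refine ⟨by rw [pow_succ, mul_add, mul_one]; exact h2, ?_⟩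
    rw [pow_succ, e, hF.sg_mul]
    exact hF.sg_congr _ _ (by ring) (pow_succ _ _).symm

theorem lift {β : Type*} (b : β → hF.gr) (b' : β → A) (hb : ∀ k, ∃ d h, b k = hF.sg d (b' k) h)
    (Y : Set A) (S2 : Set hF.gr) (hS2 : ∀ s ∈ S2, ∃ d, ∃ y ∈ Y, ∃ h, s = hF.sg d y h)
    {n : ℕ} {a : A} (ha : a ∈ F n)
    (h : hF.sg n a ha ∈ AddSubgroup.closure (Set.range b) ⊔ (Submodule.span hF.gr S2).toAddSubgroup) :
    ∃ s ∈ AddSubgroup.closure (Set.range b'), ∃ r ∈ Submodule.span A Y, a - (s + r) ∈ F (n + 1) := by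
  have h1 : ∀ z ∈ AddSubgroup.closure (Set.range b), ∃ f : hF.rees, Ideal.Quotient.mk hF.K f = z ∧
      ∀ n, f.1.coeff n ∈ AddSubgroup.closure (Set.range b') := by
    intro z hz
    induction hz using AddSubgroup.closure_induction with
    | mem y hy =>
      obtain ⟨k, rfl⟩ := hy
      obtain ⟨d, hd, e⟩ := hb k
      refine ⟨⟨monomial d (b' k), hF.mono_mem hd⟩, e.symm, fun n => ?_⟩
      change (monomial d (b' k)).coeff n ∈ _
      rw [coeff_monomial]
      split_ifs
      · exact AddSubgroup.subset_closure ⟨k, rfl⟩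
      · exact zero_mem _
    | zero => exact ⟨0, map_zero _, fun n => zero_mem _⟩
    | add x y _ _ hx hy =>
      obtain ⟨f, hf, hf'⟩ := hx
      obtain ⟨g, hg, hg'⟩ := hy
      refine ⟨f + g, by rw [map_add, hf, hg], fun n => ?_⟩
      rw [Subring.coe_add, coeff_add]; exact add_mem (hf' n) (hg' n)
    | neg x _ hx =>
      obtain ⟨f, hf, hf'⟩ := hx
      refine ⟨-f, by rw [map_neg, hf], fun n => ?_⟩
      change (-f.1).coeff n ∈ _
      rw [coeff_neg]; exact neg_mem (hf' n)
  have h2 : ∀ z ∈ Submodule.span hF.gr S2, ∃ f : hF.rees, Ideal.Quotient.mk hF.K f = z ∧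
      ∀ n, f.1.coeff n ∈ Submodule.span A Y := by
    intro z hz
    induction hz using Submodule.span_induction with
    | mem s hs =>
      obtain ⟨d, y, hy, hd, e⟩ := hS2 s hs
      refine ⟨⟨monomial d y, hF.mono_mem hd⟩, e.symm, fun n => ?_⟩
      change (monomial d y).coeff n ∈ _
      rw [coeff_monomial]
      split_ifs
      · exact Submodule.subset_span hy
      · exact zero_mem _
    | zero => exact ⟨0, map_zero _, fun n => zero_mem _⟩
    | add x y _ _ hx hy =>
      obtain ⟨f, hf, hf'⟩ := hx
      obtain ⟨g, hg, hg'⟩ := hy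
      refine ⟨f + g, by rw [map_add, hf, hg], fun n => ?_⟩
      rw [Subring.coe_add, coeff_add]; exact add_mem (hf' n) (hg' n)
    | smul c x _ hx =>
      obtain ⟨f, hf, hf'⟩ := hx
      obtain ⟨g, rfl⟩ := Ideal.Quotient.mk_surjective c
      refine ⟨g * f, by rw [map_mul, hf]; rfl, fun n => ?_⟩
      rw [Subring.coe_mul, coeff_mul]
      exact Submodule.sum_mem _ (fun c _ => Submodule.smul_mem _ _ (hf' _))
  obtain ⟨z1, hz1, z2, hz2, e⟩ := AddSubgroup.mem_sup.1 h
  obtain ⟨f, hf, hf'⟩ := h1 z1 hz1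
  obtain ⟨g, hg, hg'⟩ := h2 z2 hz2
  refine ⟨_, hf' n, _, hg' n, ?_⟩
  rw [sg, ← hf, ← hg, ← map_add, eq_comm, Ideal.Quotient.eq] at e
  have := e n
  simpa using this

end Filt

end

namespace GA
open IsFour
variable (p : ℕ) [Fact p.Prime] (H : Type*) [Group H]

abbrev Alg := MonoidAlgebra (ZMod p) H

noncomputable def aug : Alg p H →ₐ[ZMod p] ZMod p := MonoidAlgebra.lift (ZMod p) (ZMod p) H 1

noncomputable def I : Ideal (Alg p H) := RingHom.ker (aug p H)

instance : (I p H).IsTwoSided := by unfold I; infer_instance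

variable {p H}
noncomputable def dl (g : H) : Alg p H := MonoidAlgebra.of (ZMod p) H g - 1

theorem aug_of (g : H) : aug p H (MonoidAlgebra.of (ZMod p) H g) = 1 := by
  simp [aug]

theorem dl_mem (g : H) : (dl g : Alg p H) ∈ I p H := by
  rw [I, RingHom.mem_ker, dl, map_sub, map_one, aug_of, sub_self]

theorem smul_fixed {M : Type*} [AddCommGroup M] [Module (Alg p H) M] (m : M)
    (hm : ∀ g : H, (MonoidAlgebra.of (ZMod p) H g) • m = m) (c : Alg p H) :
    c • m = (algebraMap (ZMod p) (Alg p H) (aug p H c)) • m := by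
  induction c using MonoidAlgebra.induction_linear with
  | zero => simp
  | add f g hf hg => rw [add_smul, hf, hg, map_add, map_add, add_smul]
  | single g r =>
    have : MonoidAlgebra.single g r = algebraMap (ZMod p) (Alg p H) r * MonoidAlgebra.of (ZMod p) H g := by
      simp
    rw [this, mul_smul, hm, map_mul, aug_of, mul_one]
    congr 2
    simp [aug]

theorem nilp [Finite H] (hH : IsPGroup p H) : ∃ N, ∀ a ∈ I p H ^ N, a = 0 := by
  classical
  have : Finite (Alg p H) := by
    have : Finite (H →₀ ZMod p) := Finite.of_injective (fun f => (f : H → ZMod p)) DFunLike.coe_injective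
    exact Finite.of_equiv _ MonoidAlgebra.coeffEquiv.symm
  let T : Set (Ideal (Alg p H)) := {J | ∃ N, ∀ a ∈ I p H ^ N, ∀ m ∈ J, a * m = 0}
  have hT : T.Nonempty := ⟨⊥, 0, fun a _ m hm => by rw [(Submodule.mem_bot _).1 hm, mul_zero]⟩
  obtain ⟨J, ⟨N, hN⟩, hJ⟩ := Set.Finite.exists_maximal (Set.toFinite T) hT
  by_cases htop : J = ⊤
  · refine ⟨N, fun a ha => ?_⟩
    simpa using hN a ha 1 (by rw [htop]; trivial)
  exfalso
  have : Finite (Alg p H ⧸ J) := Finite.of_surjective _ (Submodule.Quotient.mk_surjective J)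
  have : Nontrivial (Alg p H ⧸ J) := Submodule.Quotient.nontrivial_iff.2 htop
  let : MulAction H (Alg p H ⧸ J) := MulAction.compHom _ (MonoidAlgebra.of (ZMod p) H)
  have hdvd : p ∣ Nat.card (Alg p H ⧸ J) := by
    have : Module.finrank (ZMod p) (Alg p H ⧸ J) ≠ 0 := by
      exact (Module.finrank_pos).ne'
    rw [Module.natCard_eq_pow_finrank (K := ZMod p), Nat.card_zmod]
    exact dvd_pow_self _ this
  have h0 : (0 : Alg p H ⧸ J) ∈ MulAction.fixedPoints H (Alg p H ⧸ J) := by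
    intro h; exact smul_zero (MonoidAlgebra.of (ZMod p) H h)
  obtain ⟨m, hm, hm0⟩ := hH.exists_fixed_point_of_prime_dvd_card_of_fixed_point _ hdvd h0
  obtain ⟨a, rfl⟩ := Submodule.Quotient.mk_surjective _ m
  have ha : a ∉ J := fun h => hm0 ((Submodule.Quotient.mk_eq_zero J).2 h).symm
  have hm' : ∀ g : H, (MonoidAlgebra.of (ZMod p) H g) • (Submodule.Quotient.mk a : Alg p H ⧸ J) = Submodule.Quotient.mk a := fun g => hm g
  have hIa : ∀ c ∈ I p H, c * a ∈ J := by
    intro c hc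
    rw [← smul_eq_mul, ← Submodule.Quotient.mk_eq_zero, Submodule.Quotient.mk_smul, smul_fixed _ hm',
      RingHom.mem_ker.1 hc, map_zero, zero_smul]
  have hmem : J ⊔ Submodule.span _ {a} ∈ T := by
    refine ⟨N + 1, fun b hb m hm => ?_⟩
    obtain ⟨j, hj, s, hs, rfl⟩ := Submodule.mem_sup.1 hm
    obtain ⟨c, rfl⟩ := Submodule.mem_span_singleton.1 hs
    rw [Ideal.IsTwoSided.pow_add, Submodule.pow_one] at hb
    induction hb using Submodule.mul_induction_on' with
    | mem_mul_mem x hx y hy =>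
      rw [mul_assoc, mul_add]
      apply hN _ hx
      refine add_mem (J.mul_mem_left _ hj) ?_
      rw [smul_eq_mul, ← mul_assoc]
      exact hIa _ (Ideal.mul_mem_right _ _ hy)
    | add x _ y _ hx hy => rw [add_mul, hx, hy, add_zero]
  have := hJ hmem le_sup_left
  exact ha (this (le_sup_right (a := J) (Submodule.mem_span_singleton_self a)))

noncomputable def F (p : ℕ) [Fact p.Prime] (H : Type*) [Group H] (n : ℕ) : AddSubgroup (Alg p H) := (I p H ^ n).toAddSubgroup

theorem filt : Filt (F p H) where
  zero_eq := by
    rw [F, Submodule.pow_zero, Ideal.one_eq_top]; rfl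
  anti := by
    intro n a ha
    exact (Ideal.pow_le_pow_right (Nat.le_succ n)) ha
  mul := by
    intro m n a b ha hb
    change a * b ∈ I p H ^ (m + n)
    rw [Ideal.IsTwoSided.pow_add]
    exact Ideal.mul_mem_mul ha hb

theorem F_left {n : ℕ} (c : Alg p H) {a : Alg p H} (ha : a ∈ F p H n) : c * a ∈ F p H n :=
  Ideal.mul_mem_left (I p H ^ n) c ha

theorem F_right {n : ℕ} (c : Alg p H) {a : Alg p H} (ha : a ∈ F p H n) : a * c ∈ F p H n :=
  Ideal.mul_mem_right c (I p H ^ n) ha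

theorem dl_mem_one (g : H) : (dl g : Alg p H) ∈ F p H 1 := by
  change _ ∈ I p H ^ 1
  rw [Submodule.pow_one]; exact dl_mem g

theorem dl_mul (g h : H) : (dl (g * h) : Alg p H) = MonoidAlgebra.of _ _ g * dl h + dl g := by
  simp only [dl, map_mul]; noncomm_ring

theorem dl_one : (dl (1 : H) : Alg p H) = 0 := by rw [dl, map_one, sub_self]

theorem of_eq (g : H) : MonoidAlgebra.of (ZMod p) H g = dl g + 1 := by simp [dl]

theorem dl_inv (g : H) : (dl g⁻¹ : Alg p H) = - (MonoidAlgebra.of _ _ g⁻¹ * dl g) := by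
  have := dl_mul (p := p) g⁻¹ g
  rw [inv_mul_cancel, dl_one] at this
  exact (eq_neg_of_add_eq_zero_right this.symm)

/-- dimension subgroups -/
def Dm (p : ℕ) [Fact p.Prime] (H : Type*) [Group H] (n : ℕ) : Subgroup H where
  carrier := {g | (dl g : Alg p H) ∈ F p H n}
  mul_mem' := by
    intro a b ha hb
    change (dl (a * b) : Alg p H) ∈ F p H n
    rw [dl_mul]; exact add_mem (F_left _ hb) ha
  one_mem' := by change (dl 1 : Alg p H) ∈ F p H n; rw [dl_one]; exact zero_mem _
  inv_mem' := by intro a ha; change (dl a⁻¹ : Alg p H) ∈ F p H n; rw [dl_inv]; exact neg_mem (F_left _ ha)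

theorem mem_Dm {n : ℕ} {g : H} : g ∈ Dm p H n ↔ (dl g : Alg p H) ∈ F p H n := Iff.rfl

/-- same class if quotient in next Dm -/
theorem dl_congr {n : ℕ} {g h : H} (hr : g⁻¹ * h ∈ Dm p H n) : (dl g - dl h : Alg p H) ∈ F p H n := by
  have : h = g * (g⁻¹ * h) := by group
  rw [this, dl_mul, sub_add_cancel_right]
  exact neg_mem (F_left _ hr)

theorem Dm_of {n : ℕ} {g h : H} (hr : (dl g - dl h : Alg p H) ∈ F p H n) : g⁻¹ * h ∈ Dm p H n := by
  rw [mem_Dm, dl_mul, dl_inv, ← sub_eq_add_neg, ← mul_sub]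
  apply F_left
  rw [← neg_sub]; exact neg_mem hr

/-- commutators -/
theorem dl_comm (g h : H) : dl g * dl h - dl h * dl g = MonoidAlgebra.of _ _ (h * g) * (dl ((h * g)⁻¹ * (g * h)) : Alg p H) := by
  have h1 := dl_mul (p := p) (h * g) ((h * g)⁻¹ * (g * h))
  rw [mul_inv_cancel_left] at h1
  rw [← sub_eq_iff_eq_add] at h1
  rw [← h1, dl_mul, dl_mul, of_eq, of_eq]
  noncomm_ring

end GA

namespace GA
open IsFour
variable {p : ℕ} [Fact p.Prime] {H : Type*} [Group H]

/-- signatures of elements of `fix v i` -/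
def SS (p : ℕ) [Fact p.Prime] (v : Fin 3 → H →* H) (i : Fin 3) : Set (filt (p := p) (H := H)).gr :=
  {x | ∃ d g, v i g = g ∧ ∃ h : dl g ∈ F p H d, x = (filt (p := p) (H := H)).sg d (dl g) h}

theorem dl_conj (c q : H) {n : ℕ} (hq : (dl q : Alg p H) ∈ F p H n) :
    (dl (c * q * c⁻¹) - dl q : Alg p H) ∈ F p H (n + 1) := by
  have h1 : (dl (c * q * c⁻¹) : Alg p H) = MonoidAlgebra.of _ _ c * dl q * MonoidAlgebra.of _ _ c⁻¹ := by
    simp only [dl, mul_sub, sub_mul, ← map_mul, mul_one, mul_inv_cancel, map_one]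
  have h2 : (dl (c * q * c⁻¹) - dl q : Alg p H) = MonoidAlgebra.of _ _ c * (dl q * dl c⁻¹) + dl c * dl q := by
    rw [h1]; simp only [of_eq]; noncomm_ring
  rw [h2]
  refine add_mem (F_left _ (filt.mul _ _ _ _ hq (dl_mem_one _))) ?_
  rw [add_comm n]
  exact filt.mul _ _ _ _ (dl_mem_one _) hq

theorem sys [Finite H] {v : Fin 3 → H →* H} (hv : IsFour v) : RL.Sys (SS p v) where
  zero := by
    intro i
    refine ⟨1, 1, map_one _, dl_mem_one 1, ?_⟩
    symm
    rw [filt.sg_eq_zero, dl_one]; exact zero_mem _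
  s0 := by
    rintro i _ ⟨d, g, hg, hd, rfl⟩ _ ⟨d', g', hg', hd', rfl⟩
    rw [Ring.lie_def, filt.sg_mul, filt.sg_mul, sub_eq_zero]
    apply filt.sg_congr _ _ (add_comm _ _)
    have := hv.fix_comm hg hg'
    simp only [dl, mul_sub, sub_mul, ← map_mul, this]
    noncomm_ring
  s1 := by
    rintro i j k hij hjk hik _ ⟨m, g, hg, hd, rfl⟩ _ ⟨n, h, hh, hd', rfl⟩
    have hg2 : v k g = g⁻¹ := hv.inverts hik hg
    have hh2 : v k h = h⁻¹ := hv.inverts hjk hh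
    set q := (h * g)⁻¹ * (g * h) with hq
    have hc := dl_comm (p := p) g h
    have hcm : (dl g * dl h - dl h * dl g : Alg p H) ∈ F p H (m + n) := by
      refine sub_mem (filt.mul _ _ _ _ hd hd') ?_
      rw [add_comm]; exact filt.mul _ _ _ _ hd' hd
    have hqm : (dl q : Alg p H) ∈ F p H (m + n) := by
      have : (dl q : Alg p H) = MonoidAlgebra.of _ _ (h * g)⁻¹ * (dl g * dl h - dl h * dl g) := by
        rw [hc, ← mul_assoc, ← map_mul, inv_mul_cancel, map_one, one_mul]
      rw [this]; exact F_left _ hcm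
    have hvq : v k q = (h * g) * q * (h * g)⁻¹ := by
      rw [hq]; simp only [map_mul, map_inv, hg2, hh2]; group
    obtain ⟨r, hr1, hr2, hr3, e, hr⟩ := hv.exists_root k q
    have hrD : r ∈ Dm p H (m + n + 1) := by
      rw [hr]
      apply Subgroup.pow_mem
      apply Dm_of
      rw [hvq]
      exact dl_conj _ _ hqm
    have hqr : (dl (q * r⁻¹) - dl q : Alg p H) ∈ F p H (m + n + 1) := by
      apply dl_congr
      have : (q * r⁻¹)⁻¹ * q = r := by group
      rw [this]; exact hrD
    have hqr2 : (dl (q * r⁻¹) : Alg p H) ∈ F p H (m + n) := by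
      have := add_mem (filt.anti _ hqr) hqm
      simpa using this
    refine ⟨m + n, q * r⁻¹, hr3, hqr2, ?_⟩
    rw [Ring.lie_def, filt.sg_mul, filt.sg_mul]
    rw [filt.sg_congr (filt.mul _ _ _ _ hd' hd) (by rw [add_comm]; exact filt.mul _ _ _ _ hd' hd : (dl h * dl g : Alg p H) ∈ F p H (m + n)) (add_comm _ _) rfl]
    rw [filt.sg_sub]
    apply filt.sg_eq
    rw [hc, of_eq, add_mul, one_mul, add_sub_assoc]
    refine add_mem ?_ ?_
    · rw [add_comm (m + n)]
      exact filt.mul _ _ _ _ (dl_mem_one _) hqm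
    · rw [← neg_sub]; exact neg_mem hqr

theorem dl_pow [Finite H] (hH : IsPGroup p H) {g : H} {n : ℕ} (hn : 0 < n) (hg : g ^ n = 1) :
    (dl g : Alg p H) ^ n = 0 := by
  obtain ⟨j, hj⟩ := (IsPGroup.iff_orderOf.1 hH) g
  have : CharP (Alg p H) p := charP_of_injective_algebraMap (algebraMap (ZMod p) (Alg p H)).injective p
  have h1 : (dl g : Alg p H) ^ (p ^ j) = 0 := by
    rw [dl, sub_pow_char_pow_of_commute _ _ (Commute.one_right _), ← map_pow, ← hj, pow_orderOf_eq_one, map_one, one_pow, sub_self]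
  refine pow_eq_zero_of_le ?_ h1
  rw [← hj]
  exact Nat.le_of_dvd hn (orderOf_dvd_of_pow_eq_one hg)

theorem sg_nil [Finite H] (hH : IsPGroup p H) {g : H} {n : ℕ} (hn : 0 < n) (hg : g ^ n = 1) {d : ℕ}
    (hd : (dl g : Alg p H) ∈ F p H d) : filt.sg d (dl g) hd ^ n = 0 := by
  obtain ⟨h, e⟩ := filt.sg_pow hd n
  rw [e, filt.sg_eq_zero, dl_pow hH hn hg]
  exact zero_mem _

theorem aug_algebraMap (r : ZMod p) : aug p H (algebraMap _ _ r) = r := by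
  rw [AlgHom.commutes]; rfl

theorem sub_aug (a : Alg p H) : a - algebraMap _ _ (aug p H a) ∈ AddSubgroup.closure (Set.range (dl : H → Alg p H)) := by
  induction a using MonoidAlgebra.induction_linear with
  | zero => simp
  | add f g hf hg =>
    rw [map_add, map_add, add_sub_add_comm]; exact add_mem hf hg
  | single g r =>
    have : MonoidAlgebra.single g r = r.val • MonoidAlgebra.of (ZMod p) H g := by
      rw [← Nat.cast_smul_eq_nsmul (ZMod p)]
      simp
    rw [this, map_nsmul, aug_of, map_nsmul, map_one, ← smul_sub]
    exact AddSubgroup.nsmul_mem _ (AddSubgroup.subset_closure (Set.mem_range_self g)) _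

variable (h : Fin 3 → H)

noncomputable def xx (p : ℕ) [Fact p.Prime] (h : Fin 3 → H) (i : Fin 3) : (filt (p := p) (H := H)).gr :=
  filt.sg 1 (dl (h i)) (dl_mem_one _)

theorem sg1_mem (hgen : Subgroup.closure (Set.range h) = ⊤) (g : H) :
    filt.sg 1 (dl g) (dl_mem_one g) ∈ Subring.closure (Set.range (xx p h)) := by
  have hm : ∀ a b : H, filt.sg 1 (dl (a * b) : Alg p H) (dl_mem_one _) =
      filt.sg 1 (dl a) (dl_mem_one _) + filt.sg 1 (dl b) (dl_mem_one _) := by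
    intro a b
    rw [filt.sg_add]
    apply filt.sg_eq
    rw [dl_mul, of_eq]
    have : ((dl a + 1) * dl b + dl a - (dl a + dl b) : Alg p H) = dl a * dl b := by noncomm_ring
    rw [this]
    exact filt.mul 1 1 _ _ (dl_mem_one _) (dl_mem_one _)
  have h1 : filt.sg 1 (dl (1 : H) : Alg p H) (dl_mem_one _) = 0 := by
    rw [filt.sg_eq_zero, dl_one]; exact zero_mem _
  have : g ∈ Subgroup.closure (Set.range h) := by rw [hgen]; trivial
  induction this using Subgroup.closure_induction with
  | mem y hy => obtain ⟨i, rfl⟩ := hy; exact Subring.subset_closure ⟨i, rfl⟩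
  | one => rw [h1]; exact zero_mem _
  | mul x y _ _ hx hy => rw [hm]; exact add_mem hx hy
  | inv x _ hx =>
    have := hm x x⁻¹
    rw [filt.sg_congr _ (dl_mem_one 1) rfl (by rw [mul_inv_cancel]), h1] at this
    rw [← neg_eq_of_add_eq_zero_right this.symm]
    exact neg_mem hx

theorem sg_mem (hgen : Subgroup.closure (Set.range h) = ⊤) (n : ℕ) (a : Alg p H) (ha : a ∈ F p H n) :
    filt.sg n a ha ∈ Subring.closure (Set.range (xx p h)) := by
  have hI : ∀ a ∈ I p H, ∃ h' : a ∈ F p H 1, filt.sg 1 a h' ∈ Subring.closure (Set.range (xx p h)) := by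
    intro a ha
    have h1 := sub_aug a
    rw [RingHom.mem_ker.1 ha, map_zero, sub_zero] at h1
    induction h1 using AddSubgroup.closure_induction with
    | mem y hy => obtain ⟨g, rfl⟩ := hy; exact ⟨dl_mem_one _, sg1_mem h hgen g⟩
    | zero =>
      refine ⟨zero_mem _, ?_⟩
      rw [(filt.sg_eq_zero _).2 (zero_mem _)]; exact zero_mem _
    | add x y hx hy h1 h2 =>
      have hcl : ∀ z ∈ AddSubgroup.closure (Set.range (dl : H → Alg p H)), z ∈ I p H := by
        intro z hz
        have : AddSubgroup.closure (Set.range (dl : H → Alg p H)) ≤ (I p H).toAddSubgroup := by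
          rw [AddSubgroup.closure_le]; rintro _ ⟨g, rfl⟩; exact dl_mem g
        exact this hz
      obtain ⟨h1, e1⟩ := h1 (hcl _ hx)
      obtain ⟨h2, e2⟩ := h2 (hcl _ hy)
      refine ⟨add_mem h1 h2, ?_⟩
      rw [← filt.sg_add h1 h2]; exact add_mem e1 e2
    | neg x hx h1 =>
      obtain ⟨h1, e1⟩ := h1 (by simpa using neg_mem ha)
      have h0 := zero_mem (F p H 1)
      refine ⟨neg_mem h1, ?_⟩
      rw [filt.sg_congr (neg_mem h1) (sub_mem h0 h1) rfl (zero_sub x).symm, ← filt.sg_sub h0 h1]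
      refine sub_mem ?_ e1
      rw [(filt.sg_eq_zero _).2 (zero_mem _)]; exact zero_mem _
  have hz : ∀ (a : Alg p H) (ha : a ∈ F p H 0), filt.sg 0 a ha ∈ Subring.closure (Set.range (xx p h)) := by
    intro a ha
    have hT : ∀ x : Alg p H, x ∈ F p H 0 := fun x => by rw [filt.zero_eq]; trivial
    have hk : ∀ k : ℕ, filt.sg 0 (k : Alg p H) (hT _) = k := by
      intro k
      induction k with
      | zero => rw [Nat.cast_zero, Nat.cast_zero, filt.sg_eq_zero]; exact zero_mem _
      | succ k ih =>
        rw [filt.sg_congr (hT _) (add_mem (hT _) (hT _)) rfl (Nat.cast_succ k), ← filt.sg_add (hT _) (hT _), ih, filt.sg_one]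
        simp
    rw [filt.sg_eq (hT a) (hT ((aug p H a).val : Alg p H)), hk]
    · exact natCast_mem _ _
    · change _ ∈ I p H ^ 1
      rw [Submodule.pow_one, I, RingHom.mem_ker, map_sub, map_natCast]
      simp
  induction n generalizing a with
  | zero => exact hz a ha
  | succ n ih =>
    have ha' : a ∈ I p H * I p H ^ n := by rw [← Ideal.IsTwoSided.pow_succ]; exact ha
    have key : ∃ h' : a ∈ F p H (n + 1), filt.sg (n + 1) a h' ∈ Subring.closure (Set.range (xx p h)) := by
      clear ha
      induction ha' using Submodule.mul_induction_on' with
      | mem_mul_mem x hx y hy =>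
        obtain ⟨h1, e1⟩ := hI x hx
        have h2 : x * y ∈ F p H (n + 1) := by rw [add_comm]; exact filt.mul _ _ _ _ h1 hy
        refine ⟨h2, ?_⟩
        rw [filt.sg_congr h2 (filt.mul _ _ _ _ h1 hy) (add_comm _ _) rfl, ← filt.sg_mul h1 hy]
        exact mul_mem e1 (ih y hy)
      | add x _ y _ hx hy =>
        obtain ⟨h1, e1⟩ := hx
        obtain ⟨h2, e2⟩ := hy
        refine ⟨add_mem h1 h2, ?_⟩
        rw [← filt.sg_add h1 h2]; exact add_mem e1 e2
    exact key.2

theorem thmP [Finite H] (hH : IsPGroup p H) {v : Fin 3 → H →* H} (hv : IsFour v)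
    (hgen : Subgroup.closure (Set.range h) = ⊤) {n : ℕ} (hn : 0 < n)
    (hfix : ∀ i, ∃ j, v j (h i) = h i) (hpow : ∀ i, h i ^ n = 1)
    (h0 : ∀ x, v 0 x = x → x ^ n = 1) (h1 : ∀ x, v 1 x = x → x ^ n = 1) :
    (fix v 2).index ≤ n ^ (Nat.card (RL.Idx n)) := by
  classical
  obtain ⟨b, hb1, hb2⟩ := (sys (p := p) hv).span (x := xx p h) (n := n)
    (fun i => by
      obtain ⟨j, hj⟩ := hfix i
      exact ⟨j, 1, h i, hj, dl_mem_one _, rfl⟩) hn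
    (fun i => sg_nil hH hn (hpow i) _)
    (by rintro a ⟨d, g, hg, hd, rfl⟩; exact sg_nil hH hn (h0 g hg) _)
    (by rintro a ⟨d, g, hg, hd, rfl⟩; exact sg_nil hH hn (h1 g hg) _)
  have hb : ∀ k, ∃ a d h, b k = filt.sg d a h := by
    intro k
    have := hb1 k
    generalize b k = z at this ⊢
    induction this using Submonoid.closure_induction with
    | mem y hy =>
      obtain ⟨j, d, g, -, hd, rfl⟩ := Set.mem_iUnion.1 hy
      exact ⟨_, _, hd, rfl⟩
    | one =>
      have hT : (1 : Alg p H) ∈ F p H 0 := by rw [filt.zero_eq]; trivial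
      exact ⟨1, 0, hT, (filt.sg_one hT).symm⟩
    | mul x y _ _ hx hy =>
      obtain ⟨a, d, h, rfl⟩ := hx
      obtain ⟨a', d', h', rfl⟩ := hy
      exact ⟨_, _, _, filt.sg_mul h h'⟩
  choose b' hb' using hb
  set Y : Set (Alg p H) := {y | ∃ g, v 2 g = g ∧ y = dl g} with hY
  have hall : ∀ (m : ℕ) (a : Alg p H) (ha : a ∈ F p H m), filt.sg m a ha ∈ AddSubgroup.closure (Set.range b) ⊔
      (Submodule.span (filt (p := p) (H := H)).gr (SS p v 2)).toAddSubgroup := by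
    intro m a ha
    have := sg_mem h hgen m a ha
    rw [Subring.mem_closure_iff] at this
    refine (AddSubgroup.closure_le _).2 ?_ this
    intro z hz
    obtain ⟨l, hl, rfl⟩ := Submonoid.exists_list_of_mem_closure hz
    obtain ⟨s, rfl⟩ : ∃ s : List (Fin 3), s.map (xx p h) = l := by
      have : l ∈ Set.range (List.map (xx p h)) := by
        rw [Set.range_list_map]; exact hl
      exact this
    exact hb2 s
  have hstep : ∀ (m : ℕ) (a : Alg p H), ∃ s ∈ AddSubgroup.closure (Set.range b'),
      ∃ r ∈ Submodule.span (Alg p H) Y, a - (s + r) ∈ F p H m := by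
    intro m a
    induction m with
    | zero => exact ⟨0, zero_mem _, 0, zero_mem _, by rw [filt.zero_eq]; trivial⟩
    | succ m ih =>
      obtain ⟨s, hs, r, hr, h2⟩ := ih
      obtain ⟨s', hs', r', hr', h3⟩ := filt.lift b b' hb' Y (SS p v 2)
        (by rintro _ ⟨d, g, hg, hd, rfl⟩; exact ⟨d, _, ⟨g, hg, rfl⟩, hd, rfl⟩) h2 (hall _ _ h2)
      refine ⟨s + s', add_mem hs hs', r + r', add_mem hr hr', ?_⟩
      have e : a - (s + s' + (r + r')) = a - (s + r) - (s' + r') := by abel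
      rw [e]; exact h3
  obtain ⟨N, hN⟩ := nilp hH
  have hA : ∀ a : Alg p H, ∃ s ∈ AddSubgroup.closure (Set.range b'),
      ∃ r ∈ Submodule.span (Alg p H) Y, a = s + r := by
    intro a
    obtain ⟨s, hs, r, hr, h2⟩ := hstep N a
    exact ⟨s, hs, r, hr, sub_eq_zero.1 (hN _ h2)⟩
  let π : Alg p H →+ (H ⧸ fix v 2 →₀ ZMod p) :=
    (Finsupp.mapDomain.addMonoidHom (fun g : H => (g : H ⧸ fix v 2))).comp
      (MonoidAlgebra.coeffAddEquiv.toAddMonoidHom)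
  have hπ : ∀ g r, π (MonoidAlgebra.single g r) = Finsupp.single (g : H ⧸ fix v 2) r := by
    intro g r
    simp [π]
  have hk0 : ∀ r ∈ Submodule.span (Alg p H) Y, ∀ c, π (c * r) = 0 := by
    intro r hr
    induction hr using Submodule.span_induction with
    | mem y hy =>
      obtain ⟨g, hg, rfl⟩ := hy
      intro c
      induction c using MonoidAlgebra.induction_linear with
      | zero => rw [zero_mul, map_zero]
      | add x y hx hy => rw [add_mul, map_add, hx, hy, add_zero]
      | single g' r =>
        rw [dl, mul_sub, mul_one, map_sub, MonoidAlgebra.of_apply, MonoidAlgebra.single_mul_single, mul_one, hπ, hπ,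
          sub_eq_zero]
        congr 1
        rw [eq_comm, QuotientGroup.eq]
        simpa [mem_fix] using hg
    | zero => intro c; rw [mul_zero, map_zero]
    | add x y _ _ hx hy => intro c; rw [mul_add, map_add, hx, hy, add_zero]
    | smul c x _ hx => intro d; rw [smul_eq_mul, ← mul_assoc, hx]
  have hk : ∀ r ∈ Submodule.span (Alg p H) Y, π r = 0 := fun r hr => by simpa using hk0 r hr 1
  have hspan : (⊤ : Submodule (ZMod p) (H ⧸ fix v 2 →₀ ZMod p)) ≤ Submodule.span (ZMod p) (Set.range (π ∘ b')) := by
    intro f _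
    induction f using Finsupp.induction_linear with
    | zero => exact zero_mem _
    | add f g hf hg => exact add_mem (hf trivial) (hg trivial)
    | single q r =>
      obtain ⟨g, rfl⟩ := QuotientGroup.mk_surjective q
      rw [← hπ]
      obtain ⟨s, hs, t, ht, e⟩ := hA (MonoidAlgebra.single g r)
      rw [e, map_add, hk t ht, add_zero]
      clear e
      induction hs using AddSubgroup.closure_induction with
      | mem y hy => obtain ⟨k, rfl⟩ := hy; exact Submodule.subset_span ⟨k, rfl⟩
      | zero => rw [map_zero]; exact zero_mem _
      | add x y _ _ hx hy => rw [map_add]; exact add_mem hx hy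
      | neg x _ hx => rw [map_neg]; exact neg_mem hx
  have : Fintype (RL.Idx n) := Fintype.ofFinite _
  have : Fintype (H ⧸ fix v 2) := Fintype.ofFinite _
  have h3 := finrank_range_le_card (R := ZMod p) (π ∘ b')
  rw [Set.finrank, top_le_iff.1 hspan, finrank_top, Module.finrank_finsupp_self] at h3
  rw [Subgroup.index, Nat.card_eq_fintype_card, Nat.card_eq_fintype_card]
  simpa using h3

end GA

namespace IsFour

/-- index bound -/
noncomputable def Bd (n : ℕ) : ℕ := n ^ (Nat.card (RL.Idx n))

noncomputable def E1 (e : ℕ) : ℕ := (Bd e).factorial * e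

noncomputable def EE (e : ℕ) : ℕ := (Bd (E1 e * e)).factorial * E1 e

theorem E1_pos {e : ℕ} (he : 0 < e) : 0 < E1 e := Nat.mul_pos (Nat.factorial_pos _) he

theorem EE_pos {e : ℕ} (he : 0 < e) : 0 < EE e := Nat.mul_pos (Nat.factorial_pos _) (E1_pos he)

variable {G : Type*} [Group G] [Finite G] {v : Fin 3 → G →* G} (hv : IsFour v)
include hv

theorem gen_inv {s : Fin 3 → G} (hs : ∀ i, ∃ j, v j (s i) = s i) : Inv v (Subgroup.closure (Set.range s)) := by
  intro k x hx
  induction hx using Subgroup.closure_induction with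
  | mem y hy =>
    obtain ⟨i, rfl⟩ := hy
    obtain ⟨j, hj⟩ := hs i
    by_cases h : j = k
    · rw [← h, hj]; exact Subgroup.subset_closure ⟨i, rfl⟩
    · rw [hv.inverts h hj]; exact inv_mem (Subgroup.subset_closure ⟨i, rfl⟩)
  | one => rw [map_one]; exact one_mem _
  | mul x y _ _ hx hy => rw [map_mul]; exact mul_mem hx hy
  | inv x _ hx => rw [map_inv]; exact inv_mem hx

theorem index_le {p : ℕ} [Fact p.Prime] (hG : IsPGroup p G) {n : ℕ} (hn : 0 < n)
    (h0 : ∀ x, v 0 x = x → x ^ n = 1) (h1 : ∀ x, v 1 x = x → x ^ n = 1)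
    {s : Fin 3 → G} (hs : ∀ i, ∃ j, v j (s i) = s i) (hsn : ∀ i, s i ^ n = 1) :
    ((fix v 2).subgroupOf (Subgroup.closure (Set.range s))).index ≤ Bd n := by
  set H := Subgroup.closure (Set.range s) with hH
  have hi : Inv v H := hv.gen_inv hs
  have hmem : ∀ i, s i ∈ H := fun i => Subgroup.subset_closure ⟨i, rfl⟩
  have key := GA.thmP (p := p) (H := H) (fun i => ⟨s i, hmem i⟩) (hG.to_subgroup H) (hv.restrict hi)
    (by
      rw [← Subgroup.map_injective (H.subtype_injective) |>.eq_iff, MonoidHom.map_closure, ← Set.range_comp]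
      rw [← MonoidHom.range_eq_map, Subgroup.range_subtype]
      exact hH.symm) hn
    (fun i => by obtain ⟨j, hj⟩ := hs i; exact ⟨j, Subtype.ext hj⟩)
    (fun i => Subtype.ext (hsn i))
    (fun x hx => Subtype.ext (h0 x (congrArg Subtype.val hx)))
    (fun x hx => Subtype.ext (h1 x (congrArg Subtype.val hx)))
  refine le_trans (le_of_eq ?_) key
  congr 1
  ext x
  rw [Subgroup.mem_subgroupOf, mem_fix, mem_fix, Subtype.ext_iff]
  rfl

theorem center_pow {s : Fin 3 → G} (hgen : Subgroup.closure (Set.range s) = ⊤) (hs : ∀ i, v 2 (s i) = (s i)⁻¹)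
    {n B : ℕ} (hsn : ∀ i, s i ^ n = 1) (hB : (fix v 2).index ≤ B) (x : G) : x ^ (B.factorial * n) = 1 := by
  have hN : (fix v 2).normalCore ≤ Subgroup.center G := by
    intro c hc
    rw [Subgroup.mem_center_iff]
    have : (⊤ : Subgroup G) ≤ Subgroup.centralizer {c} := by
      rw [← hgen, Subgroup.closure_le]
      rintro _ ⟨i, rfl⟩
      have h1 := hs i
      generalize s i = a at h1
      have hcf : v 2 c = c := (Subgroup.normalCore_le _) hc
      have h2 : v 2 (a * c * a⁻¹) = a * c * a⁻¹ :=
        (Subgroup.normalCore_le _) ((Subgroup.normalCore_normal _).conj_mem c hc a)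
      rw [map_mul, map_mul, map_inv, h1, hcf, inv_inv] at h2
      have h3 : Commute c (a * a) := by
        have : c * a = a * (a * c * a⁻¹) := by rw [← h2]; group
        calc c * (a * a) = c * a * a := by group
          _ = a * (a * c * a⁻¹) * a := by rw [this]
          _ = (a * a) * c := by group
      obtain ⟨m, hm⟩ := exists_rt hv.odd_card
      have h4 : (a * a) ^ m = a := by rw [(Commute.refl a).mul_pow m, hm]
      have h5 := h3.pow_right m
      rw [h4] at h5
      exact Subgroup.mem_centralizer_singleton_iff.2 h5.symm
    intro g
    exact (Subgroup.mem_centralizer_singleton_iff.1 (this (Subgroup.mem_top g)))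
  have hj : (Subgroup.center G).index ∣ B.factorial := by
    refine (Subgroup.index_dvd_of_le hN).trans (dvd_trans ?_ (Nat.factorial_dvd_factorial hB))
    rw [Subgroup.normalCore_eq_ker, Subgroup.index_ker, Subgroup.index_eq_card, ← Nat.card_perm]
    exact Subgroup.card_subgroup_dvd_card (MulAction.toPermHom G (G ⧸ fix v 2)).range
  have h6 : (x ^ (Subgroup.center G).index) ^ n = 1 := by
    have hx : x ∈ Subgroup.closure (Set.range s) := by rw [hgen]; trivial
    have hmul : ∀ a b : G, (a * b) ^ (Subgroup.center G).index = a ^ (Subgroup.center G).index * b ^ (Subgroup.center G).index :=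
      fun a b => congrArg Subtype.val (map_mul (MonoidHom.transferCenterPow G) a b)
    induction hx using Subgroup.closure_induction with
    | mem y hy =>
      obtain ⟨i, rfl⟩ := hy
      rw [← pow_mul, mul_comm, pow_mul, hsn, one_pow]
    | one => simp
    | mul a b _ _ ha hb =>
      rw [hmul, Commute.mul_pow, ha, hb, one_mul]
      exact (Subgroup.mem_center_iff.1 ((Subgroup.center G).pow_index_mem b) _)
    | inv a _ ha => rw [inv_pow, inv_pow, ha, inv_one]
  obtain ⟨k, hk⟩ := hj
  rw [hk, mul_right_comm, pow_mul, pow_mul _ _ n, h6, one_pow]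

theorem use1 {p : ℕ} [Fact p.Prime] (hG : IsPGroup p G) {e : ℕ} (he : 0 < e)
    (h0 : ∀ x, v 0 x = x → x ^ e = 1) (h1 : ∀ x, v 1 x = x → x ^ e = 1)
    {s : Fin 3 → G} (hs : ∀ i, v 0 (s i) = s i ∨ v 1 (s i) = s i) {x : G}
    (hx : x ∈ Subgroup.closure (Set.range s)) : x ^ E1 e = 1 := by
  have hs' : ∀ i, ∃ j, v j (s i) = s i := fun i => (hs i).elim (fun h => ⟨0, h⟩) (fun h => ⟨1, h⟩)
  have hsn : ∀ i, s i ^ e = 1 := fun i => (hs i).elim (h0 _) (h1 _)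
  have hidx := hv.index_le hG he h0 h1 hs' hsn
  set H := Subgroup.closure (Set.range s) with hH
  have hi : Inv v H := hv.gen_inv hs'
  have hmem : ∀ i, s i ∈ H := fun i => Subgroup.subset_closure ⟨i, rfl⟩
  have key := (hv.restrict hi).center_pow (s := fun i => ⟨s i, hmem i⟩)
    (by
      rw [← Subgroup.map_injective (H.subtype_injective) |>.eq_iff, MonoidHom.map_closure, ← Set.range_comp]
      rw [← MonoidHom.range_eq_map, Subgroup.range_subtype]
      exact hH.symm)
    (fun i => Subtype.ext ((hs i).elim (hv.inverts (by decide)) (hv.inverts (by decide))))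
    (n := e) (B := Bd e) (fun i => Subtype.ext (hsn i))
    (by
      refine le_trans (le_of_eq ?_) hidx
      congr 1
      ext x
      rw [Subgroup.mem_subgroupOf, mem_fix, mem_fix, Subtype.ext_iff]
      rfl) ⟨x, hx⟩
  exact congrArg Subtype.val key

theorem eq_one_of_inv {x : G} (h1 : v 2 x = x) (h2 : v 2 x = x⁻¹) : x = 1 := by
  apply hv.sq_inj
  rw [h1] at h2
  nth_rewrite 2 [h2]
  simp

theorem useQ {p : ℕ} [Fact p.Prime] (hG : IsPGroup p G) {e : ℕ} (he : 0 < e)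
    (h0 : ∀ x, v 0 x = x → x ^ e = 1) (h1 : ∀ x, v 1 x = x → x ^ e = 1)
    {g : G} (hg : g ∈ Subgroup.closure {x | v 0 x = x ∨ v 1 x = x}) : g ^ EE e = 1 := by
  have hdec : ∀ g ∈ Subgroup.closure {x | v 0 x = x ∨ v 1 x = x}, ∃ c a b, v 2 c = c ∧ c ^ E1 e = 1 ∧
      v 0 a = a ∧ v 1 b = b ∧ g = c * (a * b * a) := by
    intro g hg
    have hstep : ∀ (c a b s : G), v 2 c = c → c ^ E1 e = 1 → v 0 a = a → v 1 b = b → (v 0 s = s ∨ v 1 s = s) →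
        ∃ c' a' b', v 2 c' = c' ∧ c' ^ E1 e = 1 ∧ v 0 a' = a' ∧ v 1 b' = b' ∧
          c * (a * b * a) * s = c' * (a' * b' * a') := by
      intro c a b s hc hce ha hb hs
      have hs3 : ∀ i, v 0 (![a, b, s] i) = ![a, b, s] i ∨ v 1 (![a, b, s] i) = ![a, b, s] i := by
        intro i; fin_cases i
        · exact Or.inl ha
        · exact Or.inr hb
        · exact hs
      have hi := hv.gen_inv (s := ![a, b, s]) (fun i => (hs3 i).elim (fun h => ⟨0, h⟩) (fun h => ⟨1, h⟩))
      have hm : ∀ i, ![a, b, s] i ∈ Subgroup.closure (Set.range ![a, b, s]) := fun i => Subgroup.subset_closure ⟨i, rfl⟩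
      have hma : a ∈ Subgroup.closure (Set.range ![a, b, s]) := hm 0
      have hmb : b ∈ Subgroup.closure (Set.range ![a, b, s]) := hm 1
      have hms : s ∈ Subgroup.closure (Set.range ![a, b, s]) := hm 2
      obtain ⟨y, z, hy, hz, e1, hy2, hz2⟩ := hv.decomp hi 2 (mul_mem (mul_mem (mul_mem hma hmb) hma) hms)
      obtain ⟨a', b', -, -, ha', hb', e2⟩ := hv.decomp_inv (i := 0) (j := 1) (k := 2) hi (by decide) (by decide) (by decide) hz hz2
      refine ⟨c * y, a', b', by rw [map_mul, hc, hy2], ?_, ha', hb', ?_⟩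
      · rw [Commute.mul_pow (hv.fix_comm hc hy2), hce, one_mul]
        exact hv.use1 hG he h0 h1 hs3 hy
      · rw [mul_assoc c, e1, e2, mul_assoc, mul_assoc c]
    induction hg using Subgroup.closure_induction_right with
    | one => exact ⟨1, 1, 1, map_one _, one_pow _, map_one _, map_one _, by simp⟩
    | mul_right x hx y hy ih =>
      obtain ⟨c, a, b, hc, hce, ha, hb, rfl⟩ := ih
      exact hstep c a b y hc hce ha hb hy
    | mul_inv_cancel x hx y hy ih =>
      obtain ⟨c, a, b, hc, hce, ha, hb, rfl⟩ := ih
      exact hstep c a b y⁻¹ hc hce ha hb (by simpa using hy)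
  have hQ2 : ∀ g ∈ Subgroup.closure {x | v 0 x = x ∨ v 1 x = x}, v 2 g = g → g ^ E1 e = 1 := by
    intro g hg hg2
    obtain ⟨c, a, b, hc, hce, ha, hb, rfl⟩ := hdec g hg
    have hi : v 2 (a * b * a) = (a * b * a)⁻¹ := by
      simp only [map_mul, hv.inverts (j := 2) (by decide) ha, hv.inverts (j := 2) (by decide) hb]; group
    rw [map_mul, hc, mul_right_inj] at hg2
    rw [hv.eq_one_of_inv hg2 hi, mul_one, hce]
  obtain ⟨c, a, b, hc, hce, ha, hb, e1⟩ := hdec g hg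
  have haQ : a ∈ Subgroup.closure {x | v 0 x = x ∨ v 1 x = x} := Subgroup.subset_closure (Or.inl ha)
  have hbQ : b ∈ Subgroup.closure {x | v 0 x = x ∨ v 1 x = x} := Subgroup.subset_closure (Or.inr hb)
  have hcQ : c ∈ Subgroup.closure {x | v 0 x = x ∨ v 1 x = x} := by
    have : c = g * (a * b * a)⁻¹ := by rw [e1]; group
    rw [this]; exact mul_mem hg (inv_mem (mul_mem (mul_mem haQ hbQ) haQ))
  have hle : Subgroup.closure (Set.range ![a, b, c]) ≤ Subgroup.closure {x | v 0 x = x ∨ v 1 x = x} := by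
    rw [Subgroup.closure_le]
    rintro _ ⟨i, rfl⟩
    fin_cases i
    exacts [haQ, hbQ, hcQ]
  have hmul : ∀ x : G, x ^ e = 1 → x ^ (E1 e * e) = 1 := fun x hx => by rw [mul_comm, pow_mul, hx, one_pow]
  have hidx := hv.index_le hG (Nat.mul_pos (E1_pos he) he) (fun x hx => hmul x (h0 x hx)) (fun x hx => hmul x (h1 x hx))
    (s := ![a, b, c])
    (by
      intro i; fin_cases i
      · exact ⟨0, ha⟩
      · exact ⟨1, hb⟩
      · exact ⟨2, hc⟩)
    (by
      intro i; fin_cases i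
      · exact hmul _ (h0 _ ha)
      · exact hmul _ (h1 _ hb)
      · change c ^ _ = 1
        rw [pow_mul, hce, one_pow])
  have hm : ∀ i, ![a, b, c] i ∈ Subgroup.closure (Set.range ![a, b, c]) := fun i => Subgroup.subset_closure ⟨i, rfl⟩
  have hgm : g ∈ Subgroup.closure (Set.range ![a, b, c]) := by
    rw [e1]; exact mul_mem (hm 2) (mul_mem (mul_mem (hm 0) (hm 1)) (hm 0))
  obtain ⟨k, hk0, hk, hkm⟩ := Subgroup.exists_pow_mem_of_index_ne_zero (Subgroup.index_ne_zero_of_finite (H := (fix v 2).subgroupOf (Subgroup.closure (Set.range ![a, b, c])))) ⟨g, hgm⟩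
  rw [Subgroup.mem_subgroupOf] at hkm
  have h3 : (g ^ k) ^ E1 e = 1 := hQ2 _ (pow_mem hg k) hkm
  obtain ⟨m, hm⟩ := Nat.dvd_factorial hk0 (hk.trans hidx)
  rw [EE, hm, mul_right_comm, pow_mul, pow_mul, h3, one_pow]

end IsFour

theorem grun {G : Type*} [Group G] [Finite G] {p : ℕ} [hp : Fact p.Prime] (P : Subgroup G) (hP : IsPGroup p P)
    (hidx : ¬ p ∣ P.index) {A : Type*} [CommGroup A] (ϕ : P →* A) {E M : ℕ} (hEM : E ∣ M)
    (hE : ∀ y : P, ϕ y = 1 → y ^ E = 1)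
    (hN : ∀ g : G, (∀ z ∈ P, g⁻¹ * z * g ∈ P) → ∀ (x : G) (hx : x ∈ P) (h : g⁻¹ * x * g ∈ P),
      ϕ ⟨g⁻¹ * x * g, h⟩ ^ M = ϕ ⟨x, hx⟩ ^ M)
    (hτ : ∀ g : G, (MonoidHom.transfer ϕ g) ^ M = 1) (x : P) : ϕ x ^ M = 1 := by
  classical
  let χ : G → A := fun z => if h : z ∈ P then ϕ ⟨z, h⟩ ^ M else 1
  have hχ : ∀ z (h : z ∈ P), χ z = ϕ ⟨z, h⟩ ^ M := fun z h => dif_pos h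
  have χ_mul : ∀ a b, a ∈ P → b ∈ P → χ (a * b) = χ a * χ b := by
    intro a b ha hb
    rw [hχ _ (mul_mem ha hb), hχ a ha, hχ b hb, ← mul_pow, ← map_mul]; rfl
  have χ_pow : ∀ a, a ∈ P → ∀ k : ℕ, χ (a ^ k) = χ a ^ k := by
    intro a ha k
    rw [hχ _ (pow_mem ha k), hχ a ha, ← pow_mul, mul_comm, pow_mul, ← map_pow ϕ _ k]; rfl
  have χ_one : χ 1 = 1 := by rw [hχ 1 (one_mem _)]; exact (congrArg (· ^ M) (map_one ϕ)).trans (one_pow _)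
  have χ_E : ∀ t ∈ P, t ^ E = 1 → χ t = 1 := by
    intro t ht h
    obtain ⟨k, rfl⟩ := hEM
    rw [hχ t ht, pow_mul, ← map_pow]
    have : (⟨t, ht⟩ : P) ^ E = 1 := Subtype.ext h
    rw [this, map_one, one_pow]
  have ϕ_comm : ∀ a b : P, (a * b * a⁻¹ * b⁻¹) ^ E = 1 := by
    intro a b; apply hE; simp only [map_mul, map_inv]
    rw [mul_right_comm (ϕ a), mul_inv_cancel, one_mul, mul_inv_cancel]
  have χ_conj : ∀ y ∈ P, ∀ z ∈ P, χ (y⁻¹ * z * y) = χ z := by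
    intro y hy z hz
    rw [χ_mul _ _ (mul_mem (inv_mem hy) hz) hy, χ_mul _ _ (inv_mem hy) hz, mul_right_comm, ← χ_mul _ _ (inv_mem hy) hy,
      inv_mul_cancel, χ_one, one_mul]
  suffices H : ∀ n : ℕ, ∀ x ∈ P, orderOf x = n → χ x = 1 by
    have := H _ x x.2 rfl
    rwa [hχ _ x.2] at this
  clear x
  intro n
  induction n using Nat.strong_induction_on with
  | _ n ih =>
  intro x hx hxn
  have IH : ∀ z ∈ P, orderOf z < orderOf x → χ z = 1 := fun z hz hlt => ih _ (hxn ▸ hlt) z hz rfl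
  by_cases hx1 : x = 1
  · rw [hx1, χ_one]
  obtain ⟨j, hj⟩ : ∃ j, orderOf x = p ^ j := by
    obtain ⟨j, hj⟩ := (IsPGroup.iff_orderOf.1 hP) ⟨x, hx⟩
    exact ⟨j, by rw [← hj, ← Subgroup.orderOf_coe]⟩
  have hconj : ∀ g z : G, orderOf (g⁻¹ * z * g) = orderOf z := by
    intro g z
    have := orderOf_injective (MulAut.conj g⁻¹).toMonoidHom (MulAut.conj g⁻¹).injective z
    simpa [MulAut.conj_apply] using this
  have hpx : p ∣ orderOf x := by
    rw [hj]
    refine dvd_pow_self p ?_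
    rintro rfl
    rw [pow_zero, orderOf_eq_one_iff] at hj
    exact hx1 hj
  have hpow : ∀ k, p ∣ k → ∀ z : G, orderOf z = orderOf x → orderOf (z ^ k) < orderOf x := by
    intro k hk z hz
    have hpos := orderOf_pos x
    rw [orderOf_pow z, hz]
    apply Nat.div_lt_self hpos
    exact lt_of_lt_of_le hp.out.one_lt (Nat.le_of_dvd (Nat.gcd_pos_of_pos_left _ hpos) (Nat.dvd_gcd hpx hk))
  let c : G ⧸ P → A := fun q => χ (q.out⁻¹ * x * q.out)
  have hfix : ∀ (y g : G), y • (g : G ⧸ P) = g ↔ g⁻¹ * y * g ∈ P := by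
    intro y g
    rw [MulAction.Quotient.smul_coe, eq_comm, QuotientGroup.eq, smul_eq_mul, mul_assoc]
  have hc : ∀ g : G, g⁻¹ * x * g ∈ P → c (g : G ⧸ P) = χ (g⁻¹ * x * g) := by
    intro g hg
    obtain ⟨y, hy⟩ := QuotientGroup.mk_out_eq_mul P g
    change χ _ = _
    rw [hy]
    have : (g * y)⁻¹ * x * (g * y) = (y : G)⁻¹ * (g⁻¹ * x * g) * y := by group
    rw [this, χ_conj _ y.2 _ hg]
  have hcP : ∀ (y : P) (q : G ⧸ P), x • q = q → x • (y • q) = y • q → c (y • q) = c q := by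
    intro y q h1 h2
    induction q using QuotientGroup.induction_on with
    | H g =>
    have e1 : (y • (g : G ⧸ P)) = ((y * g : G) : G ⧸ P) := rfl
    rw [e1] at h2 ⊢
    have h1' := (hfix _ _).1 h1
    have h2' := (hfix _ _).1 h2
    rw [hc _ h1', hc _ h2']
    set t := (g⁻¹ * x * g)⁻¹ * (((y : G) * g)⁻¹ * x * (y * g)) with ht
    have htP : t ∈ P := mul_mem (inv_mem h1') h2'
    have e2 : ((y : G) * g)⁻¹ * x * (y * g) = (g⁻¹ * x * g) * t := by rw [ht]; group
    rw [e2, χ_mul _ _ h1' htP]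
    have h3 : t ^ E = 1 := by
      have h4 := congrArg Subtype.val (ϕ_comm ⟨x, hx⟩⁻¹ y⁻¹)
      have h5 : t = g⁻¹ * ((⟨x, hx⟩⁻¹ * y⁻¹ * (⟨x, hx⟩⁻¹)⁻¹ * (y⁻¹)⁻¹ : P) : G) * g⁻¹⁻¹ := by
        rw [ht]; push_cast; group
      rw [h5, conj_pow, ← Subgroup.coe_pow, h4]; simp
    rw [χ_E t htP h3, mul_one]
  have hcN : ∀ q : G ⧸ P, (∀ y : P, y • q = q) → c q = χ x := by
    intro q hq
    induction q using QuotientGroup.induction_on with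
    | H g =>
    have h1 : ∀ z ∈ P, g⁻¹ * z * g ∈ P := fun z hz => (hfix _ _).1 (hq ⟨z, hz⟩)
    rw [hc _ (h1 x hx), hχ _ (h1 x hx), hχ _ hx]
    exact hN g h1 x hx _
  have : Fintype (G ⧸ P) := Fintype.ofFinite _
  -- the transfer
  have hT : ∏ q ∈ Finset.univ.filter (fun q : G ⧸ P => x • q = q), c q = 1 := by
    have : Fintype (Quotient (MulAction.orbitRel (Subgroup.zpowers x) (G ⧸ P))) := Fintype.ofFinite _
    rw [← hτ x, MonoidHom.transfer_eq_prod_quotient_orbitRel_zpowers_quot, ← Finset.prod_pow]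
    symm
    rw [← Finset.prod_filter_of_ne (s := Finset.univ) (p := fun o : Quotient (MulAction.orbitRel (Subgroup.zpowers x) (G ⧸ P)) => x • o.out = o.out)]
    · refine Finset.prod_bij' (fun o _ => o.out) (fun q _ => Quotient.mk _ q) ?_ ?_ ?_ ?_ ?_
      · intro o ho; simpa using ho
      · intro q hq
        have hq' : x • q = q := by simpa using hq
        have : (Quotient.mk (MulAction.orbitRel (Subgroup.zpowers x) (G ⧸ P)) q).out = q := by
          have h := Quotient.mk_out (s := MulAction.orbitRel (Subgroup.zpowers x) (G ⧸ P)) q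
          obtain ⟨⟨_, k, rfl⟩, hk⟩ := h
          rw [← hk]
          exact MulAction.mem_stabilizer_iff.1 (zpow_mem (MulAction.mem_stabilizer_iff.2 hq') k)
        simp only [Finset.mem_filter, Finset.mem_univ, true_and, this, hq']
      · intro o ho; exact Quotient.out_eq o
      · intro q hq
        have hq' : x • q = q := by simpa using hq
        have h := Quotient.mk_out (s := MulAction.orbitRel (Subgroup.zpowers x) (G ⧸ P)) q
        obtain ⟨⟨_, k, rfl⟩, hk⟩ := h
        rw [← hk]
        exact MulAction.mem_stabilizer_iff.1 (zpow_mem (MulAction.mem_stabilizer_iff.2 hq') k)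
      · intro o ho
        have hq' : x • o.out = o.out := by simpa using ho
        have h1 : Function.minimalPeriod (x • ·) o.out = 1 := Function.minimalPeriod_eq_one_iff_isFixedPt.2 hq'
        rw [← hχ]
        change χ _ = χ _
        rw [h1, pow_one]
    · intro o _ ho
      by_contra hne
      apply ho
      rw [← hχ]
      apply IH
      · exact QuotientGroup.out_conj_pow_minimalPeriod_mem P x o.out
      · rw [hconj]
        refine hpow _ ?_ x rfl
        have h1 : Function.minimalPeriod (x • ·) o.out ∣ p ^ j := by
          apply Function.IsPeriodicPt.minimalPeriod_dvd
          change (x • ·)^[p ^ j] o.out = o.out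
          rw [smul_iterate, ← hj, pow_orderOf_eq_one]
          exact one_smul _ _
        obtain ⟨i, -, hi⟩ := (Nat.dvd_prime_pow hp.out).1 h1
        rw [hi]
        refine dvd_pow_self p ?_
        rintro rfl
        rw [pow_zero, Function.minimalPeriod_eq_one_iff_isFixedPt] at hi
        exact hne hi
  -- counting
  have hcount : ∀ a : A, Nat.card {q : G ⧸ P // x • q = q ∧ c q = a} ≡
      Nat.card {q : G ⧸ P // (∀ y : P, y • q = q) ∧ c q = a} [MOD p] := by
    intro a
    let W : SubMulAction P (G ⧸ P) :=
      { carrier := {q | ∃ y : P, x • (y • q) = y • q ∧ c (y • q) = a}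
        smul_mem' := by
          rintro z q ⟨y, hy1, hy2⟩
          exact ⟨y * z⁻¹, by simpa [mul_smul] using hy1, by simpa [mul_smul] using hy2⟩ }
    have hW : ∀ q : G ⧸ P, x • q = q → q ∈ W → c q = a := by
      rintro q hq ⟨y, hy1, hy2⟩
      rw [← hy2, hcP y q hq hy1]
    have h1 : Nat.card W ≡ Nat.card (MulAction.fixedPoints P W) [MOD p] := hP.card_modEq_card_fixedPoints W
    have h2 : Nat.card W ≡ Nat.card (MulAction.fixedPoints (Subgroup.zpowers (⟨x, hx⟩ : P)) W) [MOD p] :=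
      (hP.to_subgroup (Subgroup.zpowers (⟨x, hx⟩ : P))).card_modEq_card_fixedPoints W
    have e1 : Nat.card (MulAction.fixedPoints P W) = Nat.card {q : G ⧸ P // (∀ y : P, y • q = q) ∧ c q = a} := by
      refine Nat.card_congr
        { toFun := fun w => ⟨w.1.1, fun y => congrArg Subtype.val (w.2 y), ?_⟩
          invFun := fun q => ⟨⟨q.1, 1, by rw [one_smul]; exact q.2.1 ⟨x, hx⟩, by rw [one_smul]; exact q.2.2⟩, fun y => Subtype.ext (q.2.1 y)⟩
          left_inv := fun w => rfl
          right_inv := fun w => rfl }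
      exact hW _ (congrArg Subtype.val (w.2 ⟨x, hx⟩)) w.1.2
    have e2 : Nat.card (MulAction.fixedPoints (Subgroup.zpowers (⟨x, hx⟩ : P)) W) = Nat.card {q : G ⧸ P // x • q = q ∧ c q = a} := by
      refine Nat.card_congr
        { toFun := fun w => ⟨w.1.1, congrArg Subtype.val (w.2 ⟨⟨x, hx⟩, Subgroup.mem_zpowers _⟩), ?_⟩
          invFun := fun q => ⟨⟨q.1, 1, by rw [one_smul]; exact q.2.1, by rw [one_smul]; exact q.2.2⟩, ?_⟩
          left_inv := fun w => rfl
          right_inv := fun w => rfl }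
      · exact hW _ (congrArg Subtype.val (w.2 ⟨⟨x, hx⟩, Subgroup.mem_zpowers _⟩)) w.1.2
      · rintro ⟨_, k, rfl⟩
        have h5 : (⟨x, hx⟩ : P) • q.1 = q.1 := q.2.1
        apply Subtype.ext
        exact MulAction.mem_stabilizer_iff.1 (zpow_mem (MulAction.mem_stabilizer_iff.2 h5) k)
    rw [← e1, ← e2]
    exact h2.symm.trans h1
  have hcard : ∀ a : A, (Finset.filter (fun q => c q = a) (Finset.univ.filter (fun q : G ⧸ P => x • q = q))).card =
      Nat.card {q : G ⧸ P // x • q = q ∧ c q = a} := by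
    intro a
    rw [Nat.card_eq_fintype_card, Fintype.card_subtype, Finset.filter_filter]
  have hprod := Finset.prod_comp (s := Finset.univ.filter (fun q : G ⧸ P => x • q = q)) (fun a : A => a) c
  rw [hT] at hprod
  have hne : ∀ a ∈ (Finset.univ.filter (fun q : G ⧸ P => x • q = q)).image c, a ≠ χ x →
      a ^ (Finset.filter (fun q => c q = a) (Finset.univ.filter (fun q : G ⧸ P => x • q = q))).card = 1 := by
    intro a ha hne
    rw [hcard]
    have h1 := hcount a
    have h2 : Nat.card {q : G ⧸ P // (∀ y : P, y • q = q) ∧ c q = a} = 0 := by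
      have : IsEmpty {q : G ⧸ P // (∀ y : P, y • q = q) ∧ c q = a} :=
        ⟨fun q => hne (q.2.2.symm.trans (hcN q.1 q.2.1))⟩
      exact Nat.card_of_isEmpty
    rw [h2, Nat.modEq_zero_iff_dvd] at h1
    obtain ⟨q, hq, rfl⟩ := Finset.mem_image.1 ha
    have hq' : x • q = q := by simpa using hq
    have hqP : q.out⁻¹ * x * q.out ∈ P := by
      rw [← hfix, QuotientGroup.out_eq']; exact hq'
    generalize Nat.card {q' : G ⧸ P // x • q' = q' ∧ c q' = c q} = k at h1
    change χ _ ^ k = 1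
    rw [← χ_pow _ hqP]
    exact IH _ (pow_mem hqP k) (hpow k h1 _ (hconj _ _))
  have hfin : χ x ^ Nat.card {q : G ⧸ P // x • q = q ∧ c q = χ x} = 1 := by
    rw [← hcard]
    by_cases hmem : χ x ∈ (Finset.univ.filter (fun q : G ⧸ P => x • q = q)).image c
    · rw [hprod]
      symm
      exact Finset.prod_eq_single_of_mem _ hmem (fun b hb hbne => hne b hb hbne)
    · have : Finset.filter (fun q => c q = χ x) (Finset.univ.filter (fun q : G ⧸ P => x • q = q)) = ∅ := by
        rw [Finset.filter_eq_empty_iff]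
        intro q hq h
        exact hmem (Finset.mem_image.2 ⟨q, hq, h⟩)
      rw [this, Finset.card_empty, pow_zero]
  have hcop : ¬ p ∣ Nat.card {q : G ⧸ P // x • q = q ∧ c q = χ x} := by
    intro hd
    have h1 := hcount (χ x)
    have e1 : Nat.card {q : G ⧸ P // (∀ y : P, y • q = q) ∧ c q = χ x} = Nat.card (MulAction.fixedPoints P (G ⧸ P)) :=
      Nat.card_congr (Equiv.subtypeEquivRight (fun q => ⟨fun h => h.1, fun h => ⟨h, hcN q h⟩⟩))
    have h2 : Nat.card (G ⧸ P) ≡ Nat.card (MulAction.fixedPoints P (G ⧸ P)) [MOD p] := hP.card_modEq_card_fixedPoints _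
    rw [e1] at h1
    have h3 := (h2.trans h1.symm)
    have h4 := h3.trans ((Nat.modEq_zero_iff_dvd).2 hd)
    exact hidx ((Nat.modEq_zero_iff_dvd).1 h4)
  have hpp : χ x ^ (p ^ j) = 1 := by
    rw [← χ_pow x hx, ← hj, pow_orderOf_eq_one, χ_one]
  have hcopr : Nat.Coprime (p ^ j) (Nat.card {q : G ⧸ P // x • q = q ∧ c q = χ x}) :=
    Nat.Coprime.pow_left j ((Nat.Prime.coprime_iff_not_dvd hp.out).2 hcop)
  have := orderOf_dvd_of_pow_eq_one hpp
  have := Nat.eq_one_of_dvd_coprimes hcopr (orderOf_dvd_of_pow_eq_one hpp) (orderOf_dvd_of_pow_eq_one hfin)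
  exact orderOf_eq_one_iff.1 this

namespace IsFour
variable {G : Type*} [Group G] [Finite G] {v : Fin 3 → G →* G} (hv : IsFour v)

/-- the subgroup generated by the first two centralizers -/
def QQ (v : Fin 3 → G →* G) : Subgroup G := Subgroup.closure {x | v 0 x = x ∨ v 1 x = x}

theorem inv_top (v : Fin 3 → G →* G) : Inv v (⊤ : Subgroup G) := fun _ _ _ => trivial

include hv

theorem mem_QQ {z : G} (hz : v 2 z = z⁻¹) : z ∈ QQ v := by
  obtain ⟨s, t, -, -, hs, ht, rfl⟩ := hv.decomp_inv (i := 0) (j := 1) (k := 2) (inv_top v) (by decide) (by decide)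
    (by decide) (Subgroup.mem_top z) hz
  have h1 : s ∈ QQ v := Subgroup.subset_closure (Or.inl hs)
  have h2 : t ∈ QQ v := Subgroup.subset_closure (Or.inr ht)
  exact mul_mem (mul_mem h1 h2) h1

theorem QQ_normal : (QQ v).Normal := by
  have h2 : ∀ b, v 2 b = b → ∀ q ∈ QQ v, b * q * b⁻¹ ∈ QQ v := by
    intro b hb q hq
    induction hq using Subgroup.closure_induction with
    | mem y hy =>
      apply hv.mem_QQ
      have : v 2 y = y⁻¹ := hy.elim (hv.inverts (by decide)) (hv.inverts (by decide))
      rw [map_mul, map_mul, map_inv, hb, this]; group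
    | one => simp
    | mul x y _ _ hx hy =>
      have : b * (x * y) * b⁻¹ = (b * x * b⁻¹) * (b * y * b⁻¹) := by group
      rw [this]; exact mul_mem hx hy
    | inv x _ hx =>
      have : b * x⁻¹ * b⁻¹ = (b * x * b⁻¹)⁻¹ := by group
      rw [this]; exact inv_mem hx
  constructor
  intro q hq g
  obtain ⟨y, z, -, -, rfl, hy, hz⟩ := hv.decomp (inv_top v) 2 (Subgroup.mem_top g)
  have hzQ := hv.mem_QQ hz
  have : y * z * q * (y * z)⁻¹ = y * (z * q * z⁻¹) * y⁻¹ := by group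
  rw [this]
  exact h2 y hy _ (mul_mem (mul_mem hzQ hq) (inv_mem hzQ))

theorem QQ_comm (x y : G) : x * y * x⁻¹ * y⁻¹ ∈ QQ v := by
  have := hv.QQ_normal
  rw [← QuotientGroup.eq_one_iff]
  have key : ∀ g : G, ∃ b, v 2 b = b ∧ (g : G ⧸ QQ v) = b := by
    intro g
    obtain ⟨y, z, -, -, rfl, hy, hz⟩ := hv.decomp (inv_top v) 2 (Subgroup.mem_top g)
    refine ⟨y, hy, ?_⟩
    rw [QuotientGroup.mk_mul, (QuotientGroup.eq_one_iff z).2 (hv.mem_QQ hz), mul_one]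
  obtain ⟨a, ha, ea⟩ := key x
  obtain ⟨b, hb, eb⟩ := key y
  simp only [QuotientGroup.mk_mul, QuotientGroup.mk_inv, ea, eb]
  rw [← QuotientGroup.mk_mul, hv.fix_comm ha hb, QuotientGroup.mk_mul]
  group

/-- elements of exponent e in P generate Y -/
theorem norm_trivial {P : Subgroup G} (hP : Inv v P) {e : ℕ} (h0 : ∀ x, v 0 x = x → x ^ e = 1)
    (h1 : ∀ x, v 1 x = x → x ^ e = 1) {g : G} (hg : g ∈ Subgroup.normalizer (P : Set G)) {x : G} (hx : x ∈ P) :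
    g * x * g⁻¹ * x⁻¹ ∈ Subgroup.closure {y | y ∈ P ∧ y ^ e = 1} := by
  set Y := Subgroup.closure {y | y ∈ P ∧ y ^ e = 1} with hY
  set N := Subgroup.normalizer (P : Set G) with hNdef
  have hNm : ∀ g : G, g ∈ N ↔ ∀ z, z ∈ P ↔ g * z * g⁻¹ ∈ P := fun g => Subgroup.mem_normalizer_iff
  have hPN : ∀ y ∈ P, y ∈ N := fun y hy => Subgroup.le_normalizer hy
  have hNY : ∀ g ∈ N, ∀ y ∈ Y, g * y * g⁻¹ ∈ Y := by
    intro g hg y hy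
    induction hy using Subgroup.closure_induction with
    | mem y hy =>
      refine Subgroup.subset_closure ⟨((hNm g).1 hg y).1 hy.1, ?_⟩
      rw [conj_pow, hy.2]; simp
    | one => rw [mul_one, mul_inv_cancel]; exact one_mem _
    | mul x y _ _ hx hy =>
      have : g * (x * y) * g⁻¹ = (g * x * g⁻¹) * (g * y * g⁻¹) := by group
      rw [this]; exact mul_mem hx hy
    | inv x _ hx =>
      have : g * x⁻¹ * g⁻¹ = (g * x * g⁻¹)⁻¹ := by group
      rw [this]; exact inv_mem hx
  have hNinv : Inv v N := by
    intro i g hg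
    rw [hNm] at hg ⊢
    have hPi : ∀ z, v i z ∈ P ↔ z ∈ P := fun z => ⟨fun h => by simpa [hv.sq] using hP i _ h, hP i z⟩
    intro z
    rw [← hPi z, hg (v i z), ← hPi]
    simp only [map_mul, map_inv, hv.sq]
  have hzY : ∀ z ∈ P, v 2 z = z⁻¹ → z ∈ Y := by
    intro z hz hz2
    obtain ⟨s, t, hsP, htP, hs, ht, rfl⟩ := hv.decomp_inv (i := 0) (j := 1) (k := 2) hP (by decide) (by decide)
      (by decide) hz hz2
    have h3 : s ∈ Y := Subgroup.subset_closure ⟨hsP, h0 s hs⟩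
    have h4 : t ∈ Y := Subgroup.subset_closure ⟨htP, h1 t ht⟩
    exact mul_mem (mul_mem h3 h4) h3
  have hv2 : ∀ x ∈ P, x⁻¹ * v 2 x ∈ Y := by
    intro x hx
    obtain ⟨y, z, hyP, hzP, rfl, hy, hz⟩ := hv.decomp hP 2 hx
    have hzz := hzY z hzP hz
    have : (y * z)⁻¹ * v 2 (y * z) = z⁻¹ * z⁻¹ := by rw [map_mul, hy, hz]; group
    rw [this]; exact mul_mem (inv_mem hzz) (inv_mem hzz)
  let T : Subgroup G :=
    { carrier := {g | g ∈ N ∧ ∀ x ∈ P, g * x * g⁻¹ * x⁻¹ ∈ Y}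
      mul_mem' := by
        rintro a b ⟨ha, ha'⟩ ⟨hb, hb'⟩
        refine ⟨mul_mem ha hb, fun x hx => ?_⟩
        have h3 := ha' _ (((hNm b).1 hb x).1 hx)
        have h4 := hb' x hx
        have : a * b * x * (a * b)⁻¹ * x⁻¹ = (a * (b * x * b⁻¹) * a⁻¹ * (b * x * b⁻¹)⁻¹) * (b * x * b⁻¹ * x⁻¹) := by group
        rw [this]; exact mul_mem h3 h4
      one_mem' := ⟨one_mem _, fun x hx => by simp [one_mem]⟩
      inv_mem' := by
        rintro a ⟨ha, ha'⟩
        refine ⟨inv_mem ha, fun x hx => ?_⟩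
        have hy := ((hNm a⁻¹).1 (inv_mem ha) x).1 hx
        have h3 := inv_mem (ha' _ hy)
        have : a⁻¹ * x * a⁻¹⁻¹ * x⁻¹ = (a * (a⁻¹ * x * a⁻¹⁻¹) * a⁻¹ * (a⁻¹ * x * a⁻¹⁻¹)⁻¹)⁻¹ := by group
        rw [this]; exact h3 }
  have hwT : ∀ w ∈ N, v 2 w = w⁻¹ → w ∈ T := by
    intro w hw hw2
    have hsq : w * w ∈ T := by
      refine ⟨mul_mem hw hw, fun x hx => ?_⟩
      -- use x' = w x w⁻¹ with x' = w (w⁻¹ x0 w) ...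
      have hx1 := ((hNm w).1 hw x).1 hx
      have hw' := inv_mem hw
      -- apply to a = w x w⁻¹ : v 2 a = w⁻¹ v2(x) w
      have e1 : v 2 (w * x * w⁻¹) = w⁻¹ * v 2 x * w := by
        simp only [map_mul, map_inv, hw2, inv_inv]
      have h3 := hv2 _ hx1
      rw [e1] at h3
      have h4 := hNY _ hw' _ (hv2 x hx)
      -- w⁻¹ x⁻¹ v2 x w ∈ Y
      have h5 : (w * x * w⁻¹)⁻¹ * (w⁻¹ * x * w) ∈ Y := by
        have : (w * x * w⁻¹)⁻¹ * (w⁻¹ * x * w) = ((w * x * w⁻¹)⁻¹ * (w⁻¹ * v 2 x * w)) * (w⁻¹ * (x⁻¹ * v 2 x) * w⁻¹⁻¹)⁻¹ := by group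
        rw [this]; exact mul_mem h3 (inv_mem h4)
      have h6 := hNY _ hw _ h5
      have h7 := inv_mem (hNY _ (hPN x hx) _ h6)
      have h8 : w * w * x * (w * w)⁻¹ * x⁻¹ = (x * (w * ((w * x * w⁻¹)⁻¹ * (w⁻¹ * x * w)) * w⁻¹) * x⁻¹)⁻¹ := by simp only [mul_inv_rev, inv_inv, mul_assoc, mul_inv_cancel_left, inv_mul_cancel_left]
      rw [h8]; exact h7
    obtain ⟨m, hm⟩ := exists_rt hv.odd_card
    have h4 : (w * w) ^ m = w := by rw [(Commute.refl w).mul_pow m, hm]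
    rw [← h4]; exact pow_mem hsq m
  have hbT : ∀ b ∈ N, v 2 b = b → b ∈ T := by
    intro b hb hb2
    refine ⟨hb, fun x hx => ?_⟩
    obtain ⟨y, z, hyP, hzP, rfl, hy, hz⟩ := hv.decomp hP 2 hx
    have hzz := hzY z hzP hz
    have hc : b * y = y * b := hv.fix_comm hb2 hy
    have : b * (y * z) * b⁻¹ * (y * z)⁻¹ = y * ((b * z * b⁻¹) * z⁻¹) * y⁻¹ := by
      rw [← mul_assoc b y z, hc]; group
    rw [this]
    exact hNY _ (hPN y hyP) _ (mul_mem (hNY _ hb _ hzz) (inv_mem hzz))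
  obtain ⟨b, w, hb, hw, rfl, hb2, hw2⟩ := hv.decomp hNinv 2 hg
  exact (mul_mem (hbT b hb hb2) (hwT w hw hw2) : b * w ∈ T).2 x hx

noncomputable def FF (e : ℕ) : ℕ := e * EE e * EE e

omit hv [Finite G] in
theorem FF_pos {e : ℕ} (he : 0 < e) : 0 < FF e := Nat.mul_pos (Nat.mul_pos he (EE_pos he)) (EE_pos he)

theorem p_part {e : ℕ} (he : 0 < e) (h0 : ∀ x, v 0 x = x → x ^ e = 1) (h1 : ∀ x, v 1 x = x → x ^ e = 1)
    (hgen : QQ v = ⊤) {p : ℕ} [hp : Fact p.Prime] (g : G) (k : ℕ) (hg : orderOf g = p ^ k) : g ^ FF e = 1 := by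
  obtain ⟨P, hP⟩ := hv.exists_sylow p
  have hw := hv.restrict hP
  have hPp : IsPGroup p (P : Subgroup G) := P.isPGroup'
  set w : Fin 3 → (P : Subgroup G) →* (P : Subgroup G) :=
    fun i => ((v i).comp (P : Subgroup G).subtype).codRestrict (P : Subgroup G) (fun x => hP i x x.2) with hwdef
  have hQE : ∀ y ∈ QQ w, y ^ EE e = 1 := fun y hy => hw.useQ hPp he
    (fun x hx => Subtype.ext (h0 x (congrArg Subtype.val hx)))
    (fun x hx => Subtype.ext (h1 x (congrArg Subtype.val hx))) hy
  have := hw.QQ_normal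
  let _ : CommGroup ((P : Subgroup G) ⧸ QQ w) :=
    { (inferInstance : Group ((P : Subgroup G) ⧸ QQ w)) with
      mul_comm := by
        intro a b
        obtain ⟨x, rfl⟩ := QuotientGroup.mk_surjective a
        obtain ⟨y, rfl⟩ := QuotientGroup.mk_surjective b
        have h2 := (QuotientGroup.eq_one_iff _).2 (hw.QQ_comm x y)
        simp only [QuotientGroup.mk_mul, QuotientGroup.mk_inv] at h2
        rw [mul_inv_eq_one, mul_inv_eq_iff_eq_mul] at h2
        exact h2 }
  let ϕ : (P : Subgroup G) →* (P : Subgroup G) ⧸ QQ w := QuotientGroup.mk' (QQ w)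
  have hϕ : ∀ y, ϕ y = 1 → y ∈ QQ w := fun y hy => (QuotientGroup.eq_one_iff y).1 hy
  have hY : ∀ y ∈ Subgroup.closure {y | y ∈ (P : Subgroup G) ∧ y ^ e = 1}, ∃ h : y ∈ (P : Subgroup G), ϕ ⟨y, h⟩ ^ e = 1 := by
    intro y hy
    induction hy using Subgroup.closure_induction with
    | mem y hy =>
      refine ⟨hy.1, ?_⟩
      rw [← map_pow]
      have : (⟨y, hy.1⟩ : (P : Subgroup G)) ^ e = 1 := Subtype.ext hy.2
      rw [this, map_one]
    | one => exact ⟨one_mem _, by rw [← map_pow]; exact (congrArg ϕ (one_pow e)).trans (map_one ϕ)⟩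
    | mul x y _ _ hx hy =>
      obtain ⟨a, ha⟩ := hx
      obtain ⟨b, hb⟩ := hy
      refine ⟨mul_mem a b, ?_⟩
      have : ϕ ⟨x * y, mul_mem a b⟩ = ϕ ⟨x, a⟩ * ϕ ⟨y, b⟩ := map_mul ϕ ⟨x, a⟩ ⟨y, b⟩
      rw [this, mul_pow, ha, hb, one_mul]
    | inv x _ hx =>
      obtain ⟨a, ha⟩ := hx
      refine ⟨inv_mem a, ?_⟩
      have : ϕ ⟨x⁻¹, inv_mem a⟩ = (ϕ ⟨x, a⟩)⁻¹ := map_inv ϕ ⟨x, a⟩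
      rw [this, inv_pow, ha, inv_one]
  have key : ∀ x : (P : Subgroup G), ϕ x ^ (e * EE e) = 1 := by
    refine grun (p := p) (P : Subgroup G) hPp P.not_dvd_index ϕ (Dvd.intro_left e rfl) (fun y hy => hQE y (hϕ y hy)) ?_ ?_
    · intro g hg x hx h
      have hgN : g ∈ Subgroup.normalizer ((P : Subgroup G) : Set G) := by
        have hinj : Function.Injective (fun z : (P : Subgroup G) => (⟨g⁻¹ * z * g, hg z z.2⟩ : (P : Subgroup G))) := by
          intro a b hab
          have := congrArg Subtype.val hab
          simp only [mul_left_inj, mul_right_inj] at this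
          exact Subtype.ext this
        have hsurj := Finite.surjective_of_injective hinj
        rw [Subgroup.mem_normalizer_iff'']
        intro h
        refine ⟨fun hh => hg h hh, fun hh => ?_⟩
        obtain ⟨z, hz⟩ := hsurj ⟨_, hh⟩
        have := congrArg Subtype.val hz
        simp only [mul_left_inj, mul_right_inj] at this
        rw [← this]; exact z.2
      obtain ⟨h3, h4⟩ := hY _ (hv.norm_trivial hP h0 h1 (inv_mem hgN) hx)
      have h5 : ϕ ⟨_, h3⟩ = ϕ ⟨g⁻¹ * x * g, h⟩ * (ϕ ⟨x, hx⟩)⁻¹ := by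
        rw [← map_inv, ← map_mul]
        congr 1
        exact Subtype.ext (by simp)
      rw [h5, mul_pow, inv_pow, mul_inv_eq_one] at h4
      rw [pow_mul, h4, ← pow_mul]
    · intro g
      have hgQ : g ∈ QQ v := by rw [hgen]; trivial
      induction hgQ using Subgroup.closure_induction with
      | mem y hy =>
        have : y ^ e = 1 := hy.elim (h0 y) (h1 y)
        rw [pow_mul, ← map_pow, this, map_one, one_pow]
      | one => rw [map_one, one_pow]
      | mul x y _ _ hx hy => rw [map_mul, mul_pow, hx, hy, one_mul]
      | inv x _ hx => rw [map_inv, inv_pow, hx, inv_one]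
  have hPF : ∀ x ∈ (P : Subgroup G), x ^ FF e = 1 := by
    intro x hx
    have h2 := key ⟨x, hx⟩
    rw [← map_pow] at h2
    have h3 := hQE _ (hϕ _ h2)
    rw [← pow_mul] at h3
    exact congrArg Subtype.val h3
  have hgp : IsPGroup p (Subgroup.zpowers g) := by
    apply IsPGroup.of_card (n := k)
    rw [Nat.card_zpowers, hg]
  obtain ⟨R, hR⟩ := hgp.exists_le_sylow
  obtain ⟨c, hc⟩ := MulAction.exists_smul_eq G R P
  have hcg : c * g * c⁻¹ ∈ (P : Subgroup G) := by
    rw [← hc]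
    rw [Sylow.coe_subgroup_smul]
    have := Subgroup.smul_mem_pointwise_smul g (MulAut.conj c) (R : Subgroup G) (hR (Subgroup.mem_zpowers g))
    exact this
  have := hPF _ hcg
  rw [conj_pow] at this
  simpa using this

theorem all_part {e : ℕ} (he : 0 < e) (h0 : ∀ x, v 0 x = x → x ^ e = 1) (h1 : ∀ x, v 1 x = x → x ^ e = 1)
    (hgen : QQ v = ⊤) (g : G) : g ^ FF e = 1 := by
  rw [← orderOf_dvd_iff_pow_eq_one, Nat.dvd_iff_prime_pow_dvd_dvd]
  intro p k hp hd
  have : Fact p.Prime := ⟨hp⟩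
  obtain ⟨m, hm⟩ := hd
  have hpos := orderOf_pos g
  have hm0 : m ≠ 0 := by rintro rfl; omega
  have ho : orderOf (g ^ m) = p ^ k := by
    rw [orderOf_pow_of_dvd hm0 (Dvd.intro_left _ hm.symm), hm, Nat.mul_div_cancel _ (Nat.pos_of_ne_zero hm0)]
  rw [← ho, orderOf_dvd_iff_pow_eq_one]
  exact hv.p_part he h0 h1 hgen _ k ho

theorem derived_part {e : ℕ} (he : 0 < e) (h0 : ∀ x, v 0 x = x → x ^ e = 1) (h1 : ∀ x, v 1 x = x → x ^ e = 1)
    {g : G} (hg : g ∈ commutator G) : g ^ FF e = 1 := by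
  have hi : Inv v (QQ v) := by
    intro k x hx
    induction hx using Subgroup.closure_induction with
    | mem y hy =>
      refine Subgroup.subset_closure ?_
      exact hy.imp (fun h => hv.fix_inv h) (fun h => hv.fix_inv h)
    | one => rw [map_one]; exact one_mem _
    | mul x y _ _ hx hy => rw [map_mul]; exact mul_mem hx hy
    | inv x _ hx => rw [map_inv]; exact inv_mem hx
  have hgQ : g ∈ QQ v := by
    have : commutator G ≤ QQ v := by
      rw [commutator_def, Subgroup.commutator_le]
      intro a _ b _
      exact hv.QQ_comm a b
    exact this hg
  have hgen : QQ (fun i => ((v i).comp (QQ v).subtype).codRestrict (QQ v) (fun x => hi i x x.2)) = ⊤ := by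
    rw [eq_top_iff]
    rintro ⟨x, hx⟩ -
    have : ∀ x ∈ QQ v, ∃ h : x ∈ QQ v, (⟨x, h⟩ : QQ v) ∈ QQ (fun i => ((v i).comp (QQ v).subtype).codRestrict (QQ v) (fun x => hi i x x.2)) := by
      intro x hx
      induction hx using Subgroup.closure_induction with
      | mem y hy =>
        refine ⟨Subgroup.subset_closure hy, Subgroup.subset_closure ?_⟩
        exact hy.imp (fun h => Subtype.ext h) (fun h => Subtype.ext h)
      | one => exact ⟨one_mem _, one_mem _⟩
      | mul x y _ _ hx hy =>
        obtain ⟨a, ha⟩ := hx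
        obtain ⟨b, hb⟩ := hy
        exact ⟨mul_mem a b, mul_mem ha hb⟩
      | inv x _ hx =>
        obtain ⟨a, ha⟩ := hx
        exact ⟨inv_mem a, inv_mem ha⟩
    exact (this x hx).2
  have := (hv.restrict hi).all_part he (fun x hx => Subtype.ext (h0 x (congrArg Subtype.val hx)))
    (fun x hx => Subtype.ext (h1 x (congrArg Subtype.val hx))) hgen ⟨g, hgQ⟩
  exact congrArg Subtype.val this

end IsFour


/-- **Theorem (Romano–Shumyatsky, Theorem 1.5).**
There is a function `f : ℕ → ℕ` such that whenever a Klein four-group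
`V = {1, v₁, v₂, v₃}` acts by automorphisms on a finite group `G` with
`C_G(V) = 1` and the centralizers of the two involutions `v₁, v₂` both have
exponent dividing `e > 0`, then the exponent of the derived subgroup `G'`
is at most `f e`. -/
theorem exponent_derived_bounded_of_kleinFour_action :
    ∃ f : ℕ → ℕ,
      ∀ (V : Type) [Group V] (v₁ v₂ v₃ : V),
        Nat.card V = 4 →
        v₁ * v₁ = 1 → v₂ * v₂ = 1 → v₁ * v₂ = v₂ * v₁ → v₃ = v₁ * v₂ →
        v₁ ≠ 1 → v₂ ≠ 1 → v₁ ≠ v₂ →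
      ∀ (G : Type) [Group G] [Finite G] (φ : V →* MulAut G),
        (∀ x : G, (∀ v : V, φ v x = x) → x = 1) →
        ∀ (e : ℕ), 0 < e →
        (∀ x : G, φ v₁ x = x → x ^ e = 1) →
        (∀ x : G, φ v₂ x = x → x ^ e = 1) →
        Monoid.exponent (commutator G) ≤ f e := by
  classical
  refine ⟨IsFour.FF, ?_⟩
  intro V _ v₁ v₂ v₃ hc h11 h22 hcm h3 hn1 hn2 hn12 G _ _ φ hfp e he h0 h1
  have hV : ∀ w : V, w = 1 ∨ w = v₁ ∨ w = v₂ ∨ w = v₃ := by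
    have hfin : Finite V := Nat.finite_of_card_ne_zero (by omega)
    have := Fintype.ofFinite V
    have h31 : v₃ ≠ 1 := by
      rintro rfl
      exact hn12 (mul_right_cancel (h3.symm.trans h22.symm))
    have h32 : v₃ ≠ v₂ := by
      intro h; rw [h3] at h; exact hn1 (mul_eq_right.mp h)
    have h33 : v₃ ≠ v₁ := by
      intro h; rw [h3] at h; exact hn2 (mul_eq_left.mp h)
    have hs : ({1, v₁, v₂, v₃} : Finset V) = Finset.univ := by
      rw [← Finset.card_eq_iff_eq_univ, ← Nat.card_eq_fintype_card, hc]
      rw [Finset.card_insert_of_notMem, Finset.card_insert_of_notMem, Finset.card_insert_of_notMem,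
        Finset.card_singleton]
      · simpa using h32.symm
      · simpa using ⟨hn12, h33.symm⟩
      · simpa using ⟨hn1.symm, hn2.symm, h31.symm⟩
    intro w
    have hw : w ∈ ({1, v₁, v₂, v₃} : Finset V) := by rw [hs]; exact Finset.mem_univ w
    simpa using hw
  let v : Fin 3 → G →* G := ![(φ v₁).toMonoidHom, (φ v₂).toMonoidHom, (φ v₃).toMonoidHom]
  have hap : ∀ a b x, φ a (φ b x) = φ (a * b) x := fun a b x => by rw [map_mul]; rfl
  have e0 : ∀ x, v 0 x = φ v₁ x := fun x => rfl
  have e1 : ∀ x, v 1 x = φ v₂ x := fun x => rfl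
  have e2 : ∀ x, v 2 x = φ v₃ x := fun x => rfl
  have m21 : v₂ * v₁ = v₃ := by rw [h3, hcm]
  have m13 : v₁ * v₃ = v₂ := by rw [h3, ← mul_assoc, h11, one_mul]
  have m31 : v₃ * v₁ = v₂ := by rw [h3, hcm, mul_assoc, h11, mul_one]
  have m32 : v₃ * v₂ = v₁ := by rw [h3, mul_assoc, h22, mul_one]
  have m23 : v₂ * v₃ = v₁ := by rw [h3, hcm, ← mul_assoc, h22, one_mul]
  have m33 : v₃ * v₃ = 1 := by
    nth_rewrite 1 [h3]
    rw [mul_assoc, m23, h11]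
  have hv : IsFour v := by
    refine ⟨?_, ?_, ?_⟩
    · intro i x
      fin_cases i
      · change φ v₁ (φ v₁ x) = x
        rw [hap, h11, map_one]; rfl
      · change φ v₂ (φ v₂ x) = x
        rw [hap, h22, map_one]; rfl
      · change φ v₃ (φ v₃ x) = x
        rw [hap, m33, map_one]; rfl
    · intro i j k hij hjk hik x
      fin_cases i <;> fin_cases j <;> fin_cases k <;>
        first
        | exact absurd rfl hij
        | exact absurd rfl hjk
        | exact absurd rfl hik
        | exact (hap v₁ v₂ x).trans (by rw [← h3]; rfl)
        | exact (hap v₂ v₁ x).trans (by rw [m21]; rfl)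
        | exact (hap v₁ v₃ x).trans (by rw [m13]; rfl)
        | exact (hap v₃ v₁ x).trans (by rw [m31]; rfl)
        | exact (hap v₂ v₃ x).trans (by rw [m23]; rfl)
        | exact (hap v₃ v₂ x).trans (by rw [m32]; rfl)
    · intro x hx
      refine hfp x fun w => ?_
      rcases hV w with rfl | rfl | rfl | rfl
      · rw [map_one]; rfl
      · exact hx 0
      · exact hx 1
      · exact hx 2
  refine Nat.le_of_dvd (IsFour.FF_pos he) (Monoid.exponent_dvd_of_forall_pow_eq_one fun g => ?_)
  exact Subtype.ext (hv.derived_part he (fun x hx => h0 x hx) (fun x hx => h1 x hx) g.2)
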